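/- arXiv:0909.3245 — 4 statements merged into one kernel-verified Lean document; each statement's English description precedes it below -/
import Mathlib

section
/- Suppose the entries X_{ξ l} (ξ = 1,…,n; l = 1,…,2m) of the total differential system (1.1) are ℝ-holomorphic at a point (z⁰, w⁰) ∈ G and the system (1.1) is completely solvable in G. Then there exist a neighborhood U of z⁰ and a solution w = w(z) of (1.1) on U, each component of which is ℝ-holomorphic at z⁰, satisfying w(z⁰) = w⁰; moreover this solution is unique, in the sense that any two solutions of (1.1) that are ℝ-holomorphic at z⁰ and take the value w⁰ at z⁰ coincide on a neighborhood of z⁰. -/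
open Complex

noncomputable section

/-- Directional Wirtinger-type derivative along a complex coordinate line whose
"real" direction is `v` and "imaginary" direction is `iv`:
`(D_v f − i · D_{iv} f)/2`.  Taking `iv` to be the negative of the imaginary
direction produces the conjugate Wirtinger derivative `∂̄`. -/
def wirtD {E : Type*} [NormedAddCommGroup E] [NormedSpace ℝ E]
    (v iv : E) (f : E → ℂ) : E → ℂ :=
  fun p => (fderiv ℝ f p v - Complex.I * fderiv ℝ f p iv) / 2

variable {m n : ℕ}

/-- The phase space of the total differential system (1.1). -/
abbrev TD (m n : ℕ) := (Fin m → ℂ) × (Fin n → ℂ)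

/-- Wirtinger derivative `∂_{z_j}` on the phase space. -/
def Dz (j : Fin m) : (TD m n → ℂ) → TD m n → ℂ :=
  wirtD (Pi.single j 1, 0) (Pi.single j Complex.I, 0)

/-- Wirtinger derivative `∂_{z̄_j}` on the phase space. -/
def Dzbar (j : Fin m) : (TD m n → ℂ) → TD m n → ℂ :=
  wirtD (Pi.single j 1, 0) (-Pi.single j Complex.I, 0)

/-- Wirtinger derivative `∂_{w_ξ}`. -/
def Dw (ξ : Fin n) : (TD m n → ℂ) → TD m n → ℂ :=
  wirtD (0, Pi.single ξ 1) (0, Pi.single ξ Complex.I)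

/-- Wirtinger derivative `∂_{w̄_ξ}`. -/
def Dwbar (ξ : Fin n) : (TD m n → ℂ) → TD m n → ℂ :=
  wirtD (0, Pi.single ξ 1) (0, -Pi.single ξ Complex.I)

/-- The operator `𝔛_j` associated with system (1.1). -/
def Xop (X1 X2 : Fin n → Fin m → TD m n → ℂ) (j : Fin m) (F : TD m n → ℂ) :
    TD m n → ℂ :=
  fun x => Dz j F x + ∑ ξ : Fin n,
    (X1 ξ j x * Dw ξ F x + (starRingEnd ℂ) (X2 ξ j x) * Dwbar ξ F x)

/-- The operator `𝔛_{m+j}` associated with system (1.1). -/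
def XopBar (X1 X2 : Fin n → Fin m → TD m n → ℂ) (j : Fin m) (F : TD m n → ℂ) :
    TD m n → ℂ :=
  fun x => Dzbar j F x + ∑ ξ : Fin n,
    (X2 ξ j x * Dw ξ F x + (starRingEnd ℂ) (X1 ξ j x) * Dwbar ξ F x)

/-- The Frobenius complete-solvability conditions (1.6) for system (1.1)
on `G`. -/
def CompletelySolvable (X1 X2 : Fin n → Fin m → TD m n → ℂ)
    (G : Set (TD m n)) : Prop :=
  ∀ τ : Fin n, ∀ j ζ : Fin m, ∀ x ∈ G,
    Xop X1 X2 ζ (X1 τ j) x = Xop X1 X2 j (X1 τ ζ) x ∧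
    XopBar X1 X2 ζ (X2 τ j) x = XopBar X1 X2 j (X2 τ ζ) x ∧
    Xop X1 X2 ζ (X2 τ j) x = XopBar X1 X2 j (X1 τ ζ) x

/-- Wirtinger derivative `∂_{z_j}` on the base space `ℂ^m`. -/
def DzM (j : Fin m) : ((Fin m → ℂ) → ℂ) → (Fin m → ℂ) → ℂ :=
  wirtD (Pi.single j 1) (Pi.single j Complex.I)

/-- Wirtinger derivative `∂_{z̄_j}` on the base space `ℂ^m`. -/
def DzbarM (j : Fin m) : ((Fin m → ℂ) → ℂ) → (Fin m → ℂ) → ℂ :=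
  wirtD (Pi.single j 1) (-Pi.single j Complex.I)

/-- `w` is an (ℝ-differentiable) solution of the total differential system
(1.1) on the set `U ⊆ ℂ^m`. -/
def IsSolutionOn (X1 X2 : Fin n → Fin m → TD m n → ℂ) (G : Set (TD m n))
    (U : Set (Fin m → ℂ)) (w : (Fin m → ℂ) → Fin n → ℂ) : Prop :=
  (∀ z ∈ U, (z, w z) ∈ G) ∧
  (∀ z ∈ U, ∀ ξ : Fin n, DifferentiableAt ℝ (fun y => w y ξ) z) ∧
  (∀ z ∈ U, ∀ ξ : Fin n, ∀ j : Fin m,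
    DzM j (fun y => w y ξ) z = X1 ξ j (z, w z) ∧
    DzbarM j (fun y => w y ξ) z = X2 ξ j (z, w z))

/-- ℝ-holomorphic at a point: real-analytic in the underlying real
variables (equivalently, locally the sum of an absolutely convergent power
series in the increments of the complex variables and their conjugates). -/
def RHolomorphicAt {E : Type*} [NormedAddCommGroup E] [NormedSpace ℝ E]
    (f : E → ℂ) (x : E) : Prop :=
  AnalyticAt ℝ f x


open Filter Set Topology in
/-- The superposition operator `g ↦ a (p₀ + g ·)` on continuous functions over a compact space is
analytic at `0` when `a` is analytic at `p₀`. -/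
theorem AnalyticAt.exists_superposition {K P Q : Type*} [TopologicalSpace K] [CompactSpace K]
    [NormedAddCommGroup P] [NormedSpace ℝ P] [NormedAddCommGroup Q] [NormedSpace ℝ Q]
    [CompleteSpace Q] {a : P → Q} {p₀ : P} (ha : AnalyticAt ℝ a p₀) :
    ∃ N : C(K, P) → C(K, Q), AnalyticAt ℝ N 0 ∧
      ∀ᶠ g in 𝓝 (0 : C(K, P)), ∀ t, N g t = a (p₀ + g t) := by
  obtain ⟨p, r, hp⟩ := ha
  let q : FormalMultilinearSeries ℝ C(K, P) C(K, Q) := fun n =>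
    MultilinearMap.mkContinuous
      { toFun := fun v => ⟨fun t => p n (fun i => v i t), by fun_prop⟩
        map_update_add' := by
          intro _ v i x y
          ext t
          have e : ∀ z : C(K, P), (fun j => Function.update v i z j t)
              = Function.update (fun j => v j t) i (z t) := fun z => by
            ext j
            by_cases h : j = i
            · subst h; simp
            · simp [h]
          simp [e]
        map_update_smul' := by
          intro _ v i c x
          ext t
          have e : ∀ z : C(K, P), (fun j => Function.update v i z j t)
              = Function.update (fun j => v j t) i (z t) := fun z => by
            ext j
            by_cases h : j = i
            · subst h; simp
            · simp [h]
          simp [e] }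
      ‖p n‖ (fun v => by
        refine (ContinuousMap.norm_le _ (by positivity)).2 fun t => ?_
        refine ((p n).le_opNorm _).trans ?_
        gcongr with i
        exact (v i).norm_coe_le_norm t)
  have hq : ∀ n, ‖q n‖ ≤ ‖p n‖ := fun n => MultilinearMap.mkContinuous_norm_le _ (by positivity) _
  have hrad : p.radius ≤ q.radius := by
    refine ENNReal.le_of_forall_nnreal_lt fun s hs => ?_
    obtain ⟨C, _, hC⟩ := p.norm_mul_pow_le_of_lt_radius hs
    refine q.le_radius_of_bound C fun n => le_trans ?_ (hC n)
    gcongr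
    exact hq n
  have hqpos : 0 < q.radius := hp.r_pos.trans_le (hp.r_le.trans hrad)
  refine ⟨q.sum, (q.hasFPowerSeriesOnBall hqpos).analyticAt, ?_⟩
  have hball : Metric.eball (0 : C(K, P)) r ∈ 𝓝 0 := Metric.eball_mem_nhds _ hp.r_pos
  filter_upwards [hball] with g hg t
  have hg' : g ∈ Metric.eball (0 : C(K, P)) q.radius :=
    Metric.eball_subset_eball (hp.r_le.trans hrad) hg
  have h1 := (ContinuousMap.evalCLM ℝ t).hasSum (q.hasSum hg')
  have hgt : g t ∈ Metric.eball (0 : P) r := by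
    rw [Metric.mem_eball, edist_zero_right] at hg ⊢
    refine lt_of_le_of_lt ?_ hg
    exact enorm_le_iff_norm_le.2 (g.norm_coe_le_norm t)
  exact h1.unique (hp.hasSum hgt)

open Set in
/-- The primitive vanishing at `0`, as a continuous linear operator on `C([0, 1], F)`. -/
def unitInterval.primitiveCLM (F : Type*) [NormedAddCommGroup F] [NormedSpace ℝ F] :
    C(unitInterval, F) →L[ℝ] C(unitInterval, F) :=
  LinearMap.mkContinuous
    { toFun := fun f =>
        ⟨fun t => ∫ s in (0 : ℝ)..t, IccExtend zero_le_one f s, by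
          have hc : Continuous (IccExtend (zero_le_one (α := ℝ)) f) := f.continuous.Icc_extend'
          exact (intervalIntegral.continuous_primitive
            (fun a b => hc.intervalIntegrable a b) 0).comp continuous_subtype_val⟩
      map_add' := fun f g => by
        ext t
        have hf : Continuous (IccExtend (zero_le_one (α := ℝ)) f) := f.continuous.Icc_extend'
        have hg : Continuous (IccExtend (zero_le_one (α := ℝ)) g) := g.continuous.Icc_extend'
        exact intervalIntegral.integral_add (hf.intervalIntegrable _ _) (hg.intervalIntegrable _ _)
      map_smul' := fun c f => by
        ext t
        exact intervalIntegral.integral_smul c _ }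
    1 (fun f => by
      refine (ContinuousMap.norm_le _ (by positivity)).2 fun t => ?_
      refine (intervalIntegral.norm_integral_le_of_norm_le_const
        (C := ‖f‖) fun s _ => f.norm_coe_le_norm _).trans ?_
      have h0 := t.2.1
      have h1 := t.2.2
      rw [sub_zero, abs_of_nonneg h0, one_mul]
      exact mul_le_of_le_one_right (norm_nonneg _) h1)

open Set in
theorem unitInterval.primitiveCLM_apply {F : Type*} [NormedAddCommGroup F] [NormedSpace ℝ F]
    (f : C(unitInterval, F)) (t : unitInterval) :
    unitInterval.primitiveCLM F f t = ∫ s in (0 : ℝ)..t, IccExtend zero_le_one f s := rfl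

/-- The affine-linear data of the radial equation: `(h, u) ↦ (t ↦ ((t h, u t), h))`. -/
def radialCLM (E F : Type*) [NormedAddCommGroup E] [NormedSpace ℝ E]
    [NormedAddCommGroup F] [NormedSpace ℝ F] :
    E × C(unitInterval, F) →L[ℝ] C(unitInterval, (E × F) × E) :=
  LinearMap.mkContinuous
    { toFun := fun q => ⟨fun t => (((t : ℝ) • q.1, q.2 t), q.1), by fun_prop⟩
      map_add' := fun p q => by ext t <;> simp
      map_smul' := fun c q => by
        ext t
        · simp [smul_smul, mul_comm]
        · simp
        · simp }
    1 (fun q => by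
      refine (ContinuousMap.norm_le _ (by positivity)).2 fun t => ?_
      have h1 : ‖(t : ℝ) • q.1‖ ≤ ‖q‖ := by
        rw [norm_smul, Real.norm_of_nonneg t.2.1]
        exact (mul_le_of_le_one_left (norm_nonneg _) t.2.2).trans (norm_fst_le q)
      have h2 : ‖q.2 t‖ ≤ ‖q‖ := (q.2.norm_coe_le_norm t).trans (norm_snd_le q)
      rw [one_mul]
      exact max_le (max_le h1 h2) (norm_fst_le q))

theorem radialCLM_apply {E F : Type*} [NormedAddCommGroup E] [NormedSpace ℝ E]
    [NormedAddCommGroup F] [NormedSpace ℝ F] (q : E × C(unitInterval, F)) (t : unitInterval) :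
    radialCLM E F q t = (((t : ℝ) • q.1, q.2 t), q.1) := rfl

section Frobenius

variable {E F : Type*} [NormedAddCommGroup E] [NormedSpace ℝ E]
  [NormedAddCommGroup F] [NormedSpace ℝ F]

open Filter Topology ContDiff in
/-- The radial equation `u(t) = ∫₀ᵗ A (z₀ + s h, w₀ + u(s)) h ds` is solved by a family `ψ h`
depending analytically on `h`. -/
theorem exists_analyticAt_radial [CompleteSpace E] [CompleteSpace F] {A : E × F → E →L[ℝ] F} {z₀ : E} {w₀ : F}
    (hA : AnalyticAt ℝ A (z₀, w₀)) :
    ∃ ψ c : E → C(unitInterval, F), AnalyticAt ℝ ψ 0 ∧ AnalyticAt ℝ c 0 ∧ ψ 0 = 0 ∧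
      ∀ᶠ h in 𝓝 (0 : E), ψ h = unitInterval.primitiveCLM F (c h) ∧
        ∀ t : unitInterval, c h t = A (z₀ + (t : ℝ) • h, w₀ + ψ h t) h := by
  have ha : AnalyticAt ℝ (fun p : (E × F) × E => A p.1 p.2) ((z₀, w₀), 0) := by
    have h1 : AnalyticAt ℝ (fun p : (E × F) × E => A p.1) ((z₀, w₀), 0) :=
      AnalyticAt.comp (g := A) (f := Prod.fst) hA analyticAt_fst
    exact (h1.contDiffAt.clm_apply (contDiffAt_snd (n := ω))).analyticAt
  obtain ⟨N, hN, hNe⟩ := ha.exists_superposition (K := unitInterval)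
  let c₀ : E × C(unitInterval, F) → C(unitInterval, F) := fun q => N (radialCLM E F q)
  have hc₀ : AnalyticAt ℝ c₀ 0 :=
    AnalyticAt.fun_comp (by simpa using hN) ((radialCLM E F).analyticAt 0)
  have hc₀e : ∀ᶠ q in 𝓝 (0 : E × C(unitInterval, F)), ∀ t : unitInterval,
      c₀ q t = A (z₀ + (t : ℝ) • q.1, w₀ + q.2 t) q.1 := by
    have : Tendsto (radialCLM E F) (𝓝 0) (𝓝 0) := by
      simpa using (radialCLM E F).continuous.tendsto 0
    filter_upwards [this.eventually hNe] with q hq t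
    simpa [radialCLM_apply] using hq t
  let Φ : E × C(unitInterval, F) → C(unitInterval, F) := fun q =>
    q.2 - unitInterval.primitiveCLM F (c₀ q)
  have hΦ : ContDiffAt ℝ ω Φ 0 := by
    refine AnalyticAt.contDiffAt (analyticAt_snd.sub ?_)
    exact ((unitInterval.primitiveCLM F).analyticAt _).comp hc₀
  have hc₀0 : c₀ 0 = 0 := by
    ext t
    simpa using hc₀e.self_of_nhds t
  have hinr : fderiv ℝ Φ 0 ∘L .inr ℝ E C(unitInterval, F) = .id ℝ _ := by
    have h1 : HasFDerivAt (fun u : C(unitInterval, F) => Φ (0, u))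
        (fderiv ℝ Φ 0 ∘L .inr ℝ E C(unitInterval, F)) 0 := by
      have := (hΦ.differentiableAt (by simp)).hasFDerivAt
      exact HasFDerivAt.comp (g := Φ) (0 : C(unitInterval, F)) this
        (ContinuousLinearMap.inr ℝ E C(unitInterval, F)).hasFDerivAt
    have h2 : HasFDerivAt (fun u : C(unitInterval, F) => Φ (0, u)) (.id ℝ _) 0 := by
      refine (hasFDerivAt_id (0 : C(unitInterval, F))).congr_of_eventuallyEq ?_
      have : Tendsto (fun u : C(unitInterval, F) => ((0 : E), u)) (𝓝 0) (𝓝 0) :=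
        (Continuous.prodMk_right (0 : E)).tendsto 0
      filter_upwards [this.eventually hc₀e] with u hu
      have : c₀ (0, u) = 0 := by
        ext t
        simpa using hu t
      simp [Φ, this]
    exact h1.unique h2
  have hinv : (fderiv ℝ Φ 0 ∘L .inr ℝ E C(unitInterval, F)).IsInvertible := by
    rw [hinr]
    exact ⟨.refl ℝ _, rfl⟩
  have hω : (ω : WithTop ℕ∞) ≠ 0 := by simp
  let ψ := hΦ.implicitFunction hω hinv
  have hψ : AnalyticAt ℝ ψ 0 := (hΦ.contDiffAt_implicitFunction hω hinv).analyticAt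
  have hψ0 : ψ 0 = 0 := hΦ.implicitFunction_apply_self hω hinv
  have hpair : AnalyticAt ℝ (fun h => (h, ψ h)) 0 := analyticAt_id.prod hψ
  have hpair0 : ((0 : E), ψ 0) = 0 := by rw [hψ0]; rfl
  refine ⟨ψ, fun h => c₀ (h, ψ h), hψ, AnalyticAt.fun_comp (by rwa [hpair0]) hpair, hψ0, ?_⟩
  have ht : Tendsto (fun h => (h, ψ h)) (𝓝 0) (𝓝 0) := by
    simpa [hpair0] using hpair.continuousAt.tendsto
  filter_upwards [hΦ.eventually_apply_implicitFunction hω hinv, ht.eventually hc₀e] with h h1 h2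
  refine ⟨?_, h2⟩
  have h3 : Φ (h, ψ h) = 0 := by
    rw [h1]
    simp [Φ, hc₀0]
  exact sub_eq_zero.1 h3


open Set in
/-- Under the integrability condition, a solution `q` of the variational equation along the
trajectory `t ↦ (z₀ + t h, u t)` is given by `q t = t A(z₀ + t h, u t) k`. -/
theorem eq_of_radial_variation {A : E × F → E →L[ℝ] F} {z₀ h k : E} {C : ℝ} {u q : ℝ → F}
    (hx : ∀ t ∈ Icc (0 : ℝ) 1, ‖fderiv ℝ A (z₀ + t • h, u t)‖ ≤ C ∧
      DifferentiableAt ℝ A (z₀ + t • h, u t) ∧ ∀ h' k',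
        fderiv ℝ A (z₀ + t • h, u t) (h', A (z₀ + t • h, u t) h') k' =
          fderiv ℝ A (z₀ + t • h, u t) (k', A (z₀ + t • h, u t) k') h')
    (hu : ∀ t ∈ Icc (0 : ℝ) 1, HasDerivAt u (A (z₀ + t • h, u t) h) t)
    (hq : ∀ t ∈ Icc (0 : ℝ) 1, HasDerivAt q
      (A (z₀ + t • h, u t) k + fderiv ℝ A (z₀ + t • h, u t) (t • k, q t) h) t)
    (hq0 : q 0 = 0) : q 1 = A (z₀ + h, u 1) k := by
  have hv' : ∀ t ∈ Icc (0 : ℝ) 1, HasDerivAt (fun t => q t - t • A (z₀ + t • h, u t) k)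
      (fderiv ℝ A (z₀ + t • h, u t) (0, q t - t • A (z₀ + t • h, u t) k) h) t := fun t ht => by
    have h1 : HasDerivAt (fun s : ℝ => (z₀ + s • h, u s)) (h, A (z₀ + t • h, u t) h) t := by
      refine HasDerivAt.prodMk ?_ (hu t ht)
      simpa using ((hasDerivAt_id t).smul_const h).const_add z₀
    have h2 : HasDerivAt (fun s : ℝ => A (z₀ + s • h, u s))
        (fderiv ℝ A (z₀ + t • h, u t) (h, A (z₀ + t • h, u t) h)) t :=
      HasFDerivAt.comp_hasDerivAt (l := A) t (hx t ht).2.1.hasFDerivAt h1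
    have h2' : HasDerivAt (fun s : ℝ => A (z₀ + s • h, u s) k)
        (fderiv ℝ A (z₀ + t • h, u t) (h, A (z₀ + t • h, u t) h) k) t := by
      simpa using h2.clm_apply (hasDerivAt_const t k)
    have h3 : HasDerivAt (fun t => q t - t • A (z₀ + t • h, u t) k) _ t :=
      (hq t ht).sub ((hasDerivAt_id' t).smul h2')
    refine h3.congr_deriv ?_
    have h4 : ((t • k, q t) : E × F) = t • (k, A (z₀ + t • h, u t) k) +
        (0, q t - t • A (z₀ + t • h, u t) k) := by simp
    rw [h4]
    rw [map_add, map_smul, (hx t ht).2.2 h k, add_apply, smul_apply, one_smul]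
    abel
  have hv0 := eq_zero_of_abs_deriv_le_mul_abs_self_of_eq_zero_right (K := C * ‖h‖)
    (fun t ht => (hv' t ht).continuousAt.continuousWithinAt)
    (fun t ht => (hv' t (Ico_subset_Icc_self ht)).hasDerivWithinAt) (by simp [hq0])
    (fun t ht => by
      have h1 := (fderiv ℝ A (z₀ + t • h, u t)).le_of_opNorm_le
        (hx t (Ico_subset_Icc_self ht)).1 (0, q t - t • A (z₀ + t • h, u t) k)
      have h2 : ∀ y : F, ‖((0 : E), y)‖ = ‖y‖ := fun y => by simp [Prod.norm_def]
      rw [h2] at h1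
      refine (ContinuousLinearMap.le_of_opNorm_le _ h1 h).trans_eq ?_
      ring) 1 ⟨zero_le_one, le_rfl⟩
  simpa [sub_eq_zero] using hv0

open Filter Topology Set in
/-- **Frobenius theorem**, analytic version: the total differential equation `Dw = A(z, w)` with
analytic right-hand side is solvable under the integrability condition. -/
theorem exists_analyticAt_of_frobenius [CompleteSpace E] [CompleteSpace F] {A : E × F → E →L[ℝ] F} {z₀ : E} {w₀ : F}
    (hA : AnalyticAt ℝ A (z₀, w₀))
    (hfrob : ∀ᶠ x in 𝓝 (z₀, w₀), ∀ h k,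
      fderiv ℝ A x (h, A x h) k = fderiv ℝ A x (k, A x k) h) :
    ∃ w : E → F, AnalyticAt ℝ w z₀ ∧ w z₀ = w₀ ∧ ∀ᶠ z in 𝓝 z₀, HasFDerivAt w (A (z, w z)) z := by
  obtain ⟨ψ, c, hψ, hc, hψ0, hψc⟩ := exists_analyticAt_radial hA
  obtain ⟨C, hC⟩ : ∃ C, ∀ᶠ x in 𝓝 (z₀, w₀), ‖fderiv ℝ A x‖ ≤ C := by
    refine ⟨‖fderiv ℝ A (z₀, w₀)‖ + 1, ?_⟩
    have := hA.fderiv.continuousAt.norm.eventually (gt_mem_nhds (lt_add_one _))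
    exact this.mono fun x hx => le_of_lt hx
  have hdiff : ∀ᶠ x in 𝓝 (z₀, w₀), DifferentiableAt ℝ A x :=
    hA.eventually_analyticAt.mono fun x hx => hx.differentiableAt
  obtain ⟨ε, hε, hball⟩ := Metric.eventually_nhds_iff.1 (hC.and (hdiff.and hfrob))
  have hsmall : ∀ᶠ h in 𝓝 (0 : E), ‖h‖ < ε ∧ ‖ψ h‖ < ε := by
    have h1 : Tendsto (fun h : E => ‖h‖) (𝓝 0) (𝓝 0) := by
      simpa using (continuous_norm (E := E)).tendsto 0
    have h2 : Tendsto (fun h : E => ‖ψ h‖) (𝓝 0) (𝓝 0) := by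
      simpa [hψ0] using hψ.continuousAt.norm.tendsto
    exact (h1.eventually (gt_mem_nhds hε)).and (h2.eventually (gt_mem_nhds hε))
  have hone : (1 : ℝ) ∈ Icc (0 : ℝ) 1 := ⟨zero_le_one, le_rfl⟩
  have key : ∀ᶠ h in 𝓝 (0 : E), ∀ k,
      fderiv ℝ ψ h k ⟨1, hone⟩ = A (z₀ + h, w₀ + ψ h ⟨1, hone⟩) k := by
    filter_upwards [hψc.eventually_nhds, hsmall, hψ.eventually_analyticAt,
      hc.eventually_analyticAt] with h hev hsm hψh hch k
    have hψ' : HasFDerivAt ψ (fderiv ℝ ψ h) h := hψh.differentiableAt.hasFDerivAt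
    have hc' : HasFDerivAt c (fderiv ℝ c h) h := hch.differentiableAt.hasFDerivAt
    have hψ'c' : fderiv ℝ ψ h k = unitInterval.primitiveCLM F (fderiv ℝ c h k) := by
      have h1 : HasFDerivAt ψ ((unitInterval.primitiveCLM F).comp (fderiv ℝ c h)) h :=
        ((unitInterval.primitiveCLM F).hasFDerivAt.comp h hc').congr_of_eventuallyEq
          (hev.mono fun y hy => hy.1)
      rw [hψ'.unique h1]
      rfl
    let x : unitInterval → E × F := fun t => (z₀ + (t : ℝ) • h, w₀ + ψ h t)
    have hx : ∀ t, ‖fderiv ℝ A (x t)‖ ≤ C ∧ DifferentiableAt ℝ A (x t) ∧ ∀ h k,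
        fderiv ℝ A (x t) (h, A (x t) h) k = fderiv ℝ A (x t) (k, A (x t) k) h := fun t => by
      apply hball
      rw [Prod.dist_eq]
      refine max_lt ?_ ?_
      · simp only [x, dist_self_add_left, norm_smul, Real.norm_of_nonneg t.2.1]
        exact (mul_le_of_le_one_left (norm_nonneg _) t.2.2).trans_lt hsm.1
      · simp only [x, dist_self_add_left]
        exact ((ψ h).norm_coe_le_norm t).trans_lt hsm.2
    have hct : ∀ t : unitInterval, fderiv ℝ c h k t =
        A (x t) k + fderiv ℝ A (x t) ((t : ℝ) • k, fderiv ℝ ψ h k t) h := fun t => by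
      have h1 : HasFDerivAt (fun y => c y t)
          ((ContinuousMap.evalCLM ℝ t).comp (fderiv ℝ c h)) h :=
        HasFDerivAt.comp (g := ContinuousMap.evalCLM ℝ t) h (ContinuousLinearMap.hasFDerivAt _) hc'
      have h2 : HasFDerivAt (fun y => ψ y t)
          ((ContinuousMap.evalCLM ℝ t).comp (fderiv ℝ ψ h)) h :=
        HasFDerivAt.comp (g := ContinuousMap.evalCLM ℝ t) h (ContinuousLinearMap.hasFDerivAt _) hψ'
      have h3 : HasFDerivAt (fun y : E => (z₀ + (t : ℝ) • y, w₀ + ψ y t))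
          (((t : ℝ) • ContinuousLinearMap.id ℝ E).prod
            ((ContinuousMap.evalCLM ℝ t).comp (fderiv ℝ ψ h))) h :=
        (((hasFDerivAt_id h).const_smul (t : ℝ)).const_add z₀).prodMk (h2.const_add w₀)
      have h4 := (HasFDerivAt.comp (g := A) h (hx t).2.1.hasFDerivAt h3).clm_apply
        (hasFDerivAt_id h)
      have h5 := h1.unique (h4.congr_of_eventuallyEq (hev.mono fun y hy => hy.2 t))
      simpa [x] using congrArg (fun L : E →L[ℝ] F => L k) h5
    let prim : C(unitInterval, F) → ℝ → F := fun f t =>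
      ∫ s in (0 : ℝ)..t, IccExtend zero_le_one f s
    have hprim : ∀ f : C(unitInterval, F), ∀ t : unitInterval,
        HasDerivAt (prim f) (f t) t := fun f t => by
      have hcont : Continuous (IccExtend (zero_le_one (α := ℝ)) f) := f.continuous.Icc_extend'
      have := intervalIntegral.integral_hasDerivAt_right (hcont.intervalIntegrable 0 t)
        (hcont.stronglyMeasurableAtFilter _ _) hcont.continuousAt
      simpa using this
    have hu : ∀ t : unitInterval, prim (c h) t = ψ h t := fun t => by
      rw [hev.self_of_nhds.1]
      rfl
    have hq : ∀ t : unitInterval, prim (fderiv ℝ c h k) t = fderiv ℝ ψ h k t := fun t => by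
      rw [hψ'c']
      rfl
    have hfin := eq_of_radial_variation (A := A) (z₀ := z₀) (h := h) (k := k) (C := C)
      (u := fun t => w₀ + prim (c h) t) (q := prim (fderiv ℝ c h k))
      (fun t ht => by
        have h1 := hu ⟨t, ht⟩
        simp only at h1
        rw [h1]
        exact hx ⟨t, ht⟩)
      (fun t ht => by
        have h1 := hu ⟨t, ht⟩
        have h2 : c h ⟨t, ht⟩ = A (x ⟨t, ht⟩) h := hev.self_of_nhds.2 ⟨t, ht⟩
        have h3 := (hprim (c h) ⟨t, ht⟩).const_add w₀
        simp only at h1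
        rw [h1]
        rwa [h2] at h3)
      (fun t ht => by
        have h1 := hu ⟨t, ht⟩
        have h2 := hq ⟨t, ht⟩
        have h3 := hprim (fderiv ℝ c h k) ⟨t, ht⟩
        simp only at h1 h2
        rw [h1, h2]
        rwa [hct] at h3)
      (by simp [prim])
    have h1 := hu ⟨1, hone⟩
    have h2 := hq ⟨1, hone⟩
    simp only at h1 h2
    rwa [h1, h2] at hfin
  let w : E → F := fun z => w₀ + ψ (z - z₀) ⟨1, hone⟩
  have hsub : Tendsto (fun z : E => z - z₀) (𝓝 z₀) (𝓝 0) := by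
    simpa using (continuous_sub_right z₀).tendsto z₀
  refine ⟨w, ?_, ?_, ?_⟩
  · have h1 : AnalyticAt ℝ (fun z : E => ψ (z - z₀)) z₀ :=
      AnalyticAt.fun_comp (by rwa [sub_self]) (analyticAt_id.sub analyticAt_const)
    exact analyticAt_const.add (AnalyticAt.comp (g := ContinuousMap.evalCLM ℝ (⟨1, hone⟩ : unitInterval))
      (ContinuousLinearMap.analyticAt _ _) h1)
  · simp [w, hψ0]
  · filter_upwards [hsub.eventually key, hsub.eventually hψ.eventually_analyticAt] with z hz hψz
    have h1 : HasFDerivAt (fun z : E => ψ (z - z₀)) (fderiv ℝ ψ (z - z₀)) z := by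
      simpa using! hψz.differentiableAt.hasFDerivAt.comp z ((hasFDerivAt_id z).sub_const z₀)
    have h2 : HasFDerivAt w
        ((ContinuousMap.evalCLM ℝ (⟨1, hone⟩ : unitInterval)).comp (fderiv ℝ ψ (z - z₀))) z :=
      (HasFDerivAt.comp (g := ContinuousMap.evalCLM ℝ (⟨1, hone⟩ : unitInterval)) z
        (ContinuousLinearMap.hasFDerivAt _) h1).const_add w₀
    convert h2 using 1
    ext k
    simpa [w] using (hz k).symm

open Filter Topology Set in
/-- Uniqueness of solutions of the total differential equation `Dw = A(z, w)`. -/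
theorem eventuallyEq_of_hasFDerivAt_of_analyticAt [CompleteSpace F] {A : E × F → E →L[ℝ] F} {z₀ : E} {w₀ : F}
    (hA : AnalyticAt ℝ A (z₀, w₀)) {w w' : E → F}
    (hw : ∀ᶠ z in 𝓝 z₀, HasFDerivAt w (A (z, w z)) z)
    (hw' : ∀ᶠ z in 𝓝 z₀, HasFDerivAt w' (A (z, w' z)) z)
    (h0 : w z₀ = w₀) (h0' : w' z₀ = w₀) : w =ᶠ[𝓝 z₀] w' := by
  obtain ⟨C, s, hs, hL⟩ :=
    (hA.contDiffAt (n := 1)).exists_lipschitzOnWith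
  have hev : ∀ u : E → F, (∀ᶠ z in 𝓝 z₀, HasFDerivAt u (A (z, u z)) z) → u z₀ = w₀ →
      ∀ᶠ z in 𝓝 z₀, HasFDerivAt u (A (z, u z)) z ∧ (z, u z) ∈ s := fun u hu hu0 => by
    have h1 : ContinuousAt (fun z => (z, u z)) z₀ :=
      continuousAt_id.prodMk hu.self_of_nhds.continuousAt
    refine hu.and (h1.eventually_mem ?_)
    rwa [hu0]
  obtain ⟨ε, hε, hball⟩ := Metric.eventually_nhds_iff.1 ((hev w hw h0).and (hev w' hw' h0'))
  refine Metric.eventually_nhds_iff.2 ⟨ε, hε, fun z hz => ?_⟩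
  set h := z - z₀ with hh
  have hpt : ∀ t ∈ Icc (0 : ℝ) 1, dist (z₀ + t • h) z₀ < ε := fun t ht => by
    rw [dist_self_add_left, norm_smul, Real.norm_of_nonneg ht.1]
    rw [dist_eq_norm] at hz
    exact (mul_le_of_le_one_left (norm_nonneg _) ht.2).trans_lt hz
  have hder : ∀ u : E → F, ∀ t, HasFDerivAt u (A (z₀ + t • h, u (z₀ + t • h))) (z₀ + t • h) →
      HasDerivAt (fun t : ℝ => u (z₀ + t • h)) (A (z₀ + t • h, u (z₀ + t • h)) h) t :=
    fun u t hu => by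
      refine hu.comp_hasDerivAt t ?_
      simpa using ((hasDerivAt_id t).smul_const h).const_add z₀
  have huniq := ODE_solution_unique_of_mem_Icc_right (a := 0) (b := 1) (K := C * ‖h‖₊)
    (v := fun t y => A (z₀ + t • h, y) h) (s := fun t => {y | (z₀ + t • h, y) ∈ s})
    (f := fun t : ℝ => w (z₀ + t • h)) (g := fun t : ℝ => w' (z₀ + t • h))
    (fun t ht => LipschitzOnWith.of_dist_le_mul fun y hy y' hy' => by
      have h1 := hL.dist_le_mul _ hy _ hy'
      rw [dist_eq_norm, dist_eq_norm] at h1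
      have h2 : ‖(z₀ + t • h, y) - (z₀ + t • h, y')‖ = ‖y - y'‖ := by simp [Prod.norm_def]
      rw [h2] at h1
      have h3 := ContinuousLinearMap.le_of_opNorm_le _ h1 h
      rw [dist_eq_norm, dist_eq_norm]
      refine (le_of_eq_of_le (by simp) h3).trans_eq ?_
      simp
      ring)
    (fun t ht => (hder w t (hball (hpt t ht)).1.1).continuousAt.continuousWithinAt)
    (fun t ht => (hder w t (hball (hpt t (Ico_subset_Icc_self ht))).1.1).hasDerivWithinAt)
    (fun t ht => (hball (hpt t (Ico_subset_Icc_self ht))).1.2)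
    (fun t ht => (hder w' t (hball (hpt t ht)).2.1).continuousAt.continuousWithinAt)
    (fun t ht => (hder w' t (hball (hpt t (Ico_subset_Icc_self ht))).2.1).hasDerivWithinAt)
    (fun t ht => (hball (hpt t (Ico_subset_Icc_self ht))).2.2)
    (by simp [h0, h0'])
  simpa [hh] using huniq ⟨zero_le_one, le_rfl⟩

end Frobenius

section TotalDifferential

/-- A real-linear map on `ℂ` splits into its complex-linear and conjugate-linear parts. -/
theorem ContinuousLinearMap.apply_eq_wirtinger (l : ℂ →L[ℝ] ℂ) (c : ℂ) :
    l c = c * ((l 1 - I * l I) / 2) + (starRingEnd ℂ) c * ((l 1 - I * -l I) / 2) := by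
  have h1 : l c = c.re * l 1 + c.im * l I := by
    conv_lhs => rw [show c = c.re • (1 : ℂ) + c.im • I by simp]
    rw [map_add, map_smul, map_smul, real_smul, real_smul]
  have h2 : (starRingEnd ℂ) c = c.re - c.im * I := by
    apply Complex.ext <;> simp
  rw [h1, h2]
  linear_combination (-((l 1 - I * l I) / 2)) * (re_add_im c).symm + c.im * l I * I_sq

theorem ContinuousLinearMap.apply_pi_eq_wirtinger {ι : Type*} [Fintype ι] [DecidableEq ι]
    (l : (ι → ℂ) →L[ℝ] ℂ) (h : ι → ℂ) :
    l h = ∑ j, (h j * ((l (Pi.single j 1) - I * l (Pi.single j I)) / 2) +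
      (starRingEnd ℂ) (h j) * ((l (Pi.single j 1) - I * l (-Pi.single j I)) / 2)) := by
  conv_lhs => rw [← Finset.univ_sum_single h, map_sum]
  refine Finset.sum_congr rfl fun j _ => ?_
  have := (l.comp (ContinuousLinearMap.single ℝ (fun _ : ι => ℂ) j)).apply_eq_wirtinger (h j)
  simpa using this

/-- The real-linear map `c ↦ (h ↦ c · h_j e_ξ)`. -/
def coeffCLM (ξ : Fin n) (j : Fin m) : ℂ →L[ℝ] (Fin m → ℂ) →L[ℝ] (Fin n → ℂ) :=
  (ContinuousLinearMap.compL ℝ (Fin m → ℂ) ℂ (Fin n → ℂ)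
    (ContinuousLinearMap.single ℝ (fun _ : Fin n => ℂ) ξ)).comp
    (((ContinuousLinearMap.compL ℝ (Fin m → ℂ) ℂ ℂ).flip
      (ContinuousLinearMap.proj (R := ℝ) (φ := fun _ : Fin m => ℂ) j)).comp
      (ContinuousLinearMap.mul ℝ ℂ))

/-- The real-linear map `c ↦ (h ↦ c · conj h_j e_ξ)`. -/
def coeffConjCLM (ξ : Fin n) (j : Fin m) : ℂ →L[ℝ] (Fin m → ℂ) →L[ℝ] (Fin n → ℂ) :=
  (ContinuousLinearMap.compL ℝ (Fin m → ℂ) ℂ (Fin n → ℂ)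
    (ContinuousLinearMap.single ℝ (fun _ : Fin n => ℂ) ξ)).comp
    (((ContinuousLinearMap.compL ℝ (Fin m → ℂ) ℂ ℂ).flip
      (conjCLE.toContinuousLinearMap.comp
        (ContinuousLinearMap.proj (R := ℝ) (φ := fun _ : Fin m => ℂ) j))).comp
      (ContinuousLinearMap.mul ℝ ℂ))

theorem coeffCLM_apply (ξ : Fin n) (j : Fin m) (c : ℂ) (h : Fin m → ℂ) :
    coeffCLM ξ j c h = Pi.single ξ (c * h j) := rfl

theorem coeffConjCLM_apply (ξ : Fin n) (j : Fin m) (c : ℂ) (h : Fin m → ℂ) :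
    coeffConjCLM ξ j c h = Pi.single ξ (c * (starRingEnd ℂ) (h j)) := rfl

/-- The right-hand side of the total differential system as a field of real-linear maps
`h ↦ X₁ h + X₂ (conj h)`. -/
def rhsCLM (X1 X2 : Fin n → Fin m → TD m n → ℂ) (x : TD m n) : (Fin m → ℂ) →L[ℝ] (Fin n → ℂ) :=
  ∑ ξ, ∑ j, (coeffCLM ξ j (X1 ξ j x) + coeffConjCLM ξ j (X2 ξ j x))

variable {X1 X2 : Fin n → Fin m → TD m n → ℂ}

theorem sum_coeffCLM_apply (a b : Fin n → Fin m → ℂ) (h : Fin m → ℂ) (τ : Fin n) :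
    (∑ ξ, ∑ j, (coeffCLM ξ j (a ξ j) + coeffConjCLM ξ j (b ξ j))) h τ =
      ∑ j, (a τ j * h j + b τ j * (starRingEnd ℂ) (h j)) := by
  simp only [sum_apply, add_apply, coeffCLM_apply,
    coeffConjCLM_apply, Finset.sum_apply, Pi.add_apply, Pi.single_apply]
  rw [Finset.sum_eq_single τ]
  · simp
  · intro ξ _ hξ
    simp [hξ.symm]
  · simp

theorem rhsCLM_apply (x : TD m n) (h : Fin m → ℂ) (τ : Fin n) :
    rhsCLM X1 X2 x h τ = ∑ j, (X1 τ j x * h j + X2 τ j x * (starRingEnd ℂ) (h j)) :=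
  sum_coeffCLM_apply (fun ξ j => X1 ξ j x) (fun ξ j => X2 ξ j x) h τ

theorem analyticAt_rhsCLM {x : TD m n} (h1 : ∀ ξ j, AnalyticAt ℝ (X1 ξ j) x)
    (h2 : ∀ ξ j, AnalyticAt ℝ (X2 ξ j) x) : AnalyticAt ℝ (rhsCLM X1 X2) x := by
  refine Finset.analyticAt_fun_sum _ fun ξ _ => Finset.analyticAt_fun_sum _ fun j _ => ?_
  exact (AnalyticAt.comp (ContinuousLinearMap.analyticAt _ _) (h1 ξ j)).add
    (AnalyticAt.comp (ContinuousLinearMap.analyticAt _ _) (h2 ξ j))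

theorem fderiv_rhsCLM_apply {x : TD m n} (h1 : ∀ ξ j, DifferentiableAt ℝ (X1 ξ j) x)
    (h2 : ∀ ξ j, DifferentiableAt ℝ (X2 ξ j) x) (v : TD m n) (k : Fin m → ℂ) (τ : Fin n) :
    fderiv ℝ (rhsCLM X1 X2) x v k τ =
      ∑ j, (fderiv ℝ (X1 τ j) x v * k j + fderiv ℝ (X2 τ j) x v * (starRingEnd ℂ) (k j)) := by
  have h : HasFDerivAt (rhsCLM X1 X2) (∑ ξ, ∑ j, ((coeffCLM ξ j).comp (fderiv ℝ (X1 ξ j) x) +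
      (coeffConjCLM ξ j).comp (fderiv ℝ (X2 ξ j) x))) x := by
    refine HasFDerivAt.fun_sum fun ξ _ => HasFDerivAt.fun_sum fun j _ => ?_
    exact (HasFDerivAt.comp x (ContinuousLinearMap.hasFDerivAt _) (h1 ξ j).hasFDerivAt).add
      (HasFDerivAt.comp x (ContinuousLinearMap.hasFDerivAt _) (h2 ξ j).hasFDerivAt)
  rw [h.fderiv, ← sum_coeffCLM_apply (fun ξ j => fderiv ℝ (X1 ξ j) x v)
    (fun ξ j => fderiv ℝ (X2 ξ j) x v)]
  simp only [sum_apply, add_apply, ContinuousLinearMap.comp_apply]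

/-- The derivative of `f` along the vector `(h, rhsCLM X1 X2 x h)` in terms of the operators
associated with the system. -/
theorem fderiv_apply_rhsCLM (f : TD m n → ℂ) (x : TD m n) (h : Fin m → ℂ) :
    fderiv ℝ f x (h, rhsCLM X1 X2 x h) =
      ∑ j, (h j * Xop X1 X2 j f x + (starRingEnd ℂ) (h j) * XopBar X1 X2 j f x) := by
  have e1 : ∀ v, fderiv ℝ f x (v, 0) = ∑ j, (v j * Dz j f x + (starRingEnd ℂ) (v j) *
      Dzbar j f x) := fun v => by
    have := ((fderiv ℝ f x).comp (.inl ℝ (Fin m → ℂ) (Fin n → ℂ))).apply_pi_eq_wirtinger v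
    simpa [Dz, Dzbar, wirtD] using this
  have e2 : ∀ v, fderiv ℝ f x (0, v) = ∑ ξ, (v ξ * Dw ξ f x + (starRingEnd ℂ) (v ξ) *
      Dwbar ξ f x) := fun v => by
    have := ((fderiv ℝ f x).comp (.inr ℝ (Fin m → ℂ) (Fin n → ℂ))).apply_pi_eq_wirtinger v
    simpa [Dw, Dwbar, wirtD] using this
  have e3 : ((h, rhsCLM X1 X2 x h) : TD m n) = (h, 0) + (0, rhsCLM X1 X2 x h) := by simp
  rw [e3, map_add, e1, e2]
  simp only [rhsCLM_apply, Xop, XopBar, map_sum, map_add, map_mul, starRingEnd_self_apply,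
    Finset.sum_mul, ← Finset.sum_add_distrib]
  rw [Finset.sum_comm, ← Finset.sum_add_distrib]
  refine Finset.sum_congr rfl fun j _ => ?_
  rw [mul_add, mul_add, Finset.mul_sum, Finset.mul_sum, add_add_add_comm,
    ← Finset.sum_add_distrib]
  congr 1
  refine Finset.sum_congr rfl fun ξ _ => ?_
  ring

theorem CompletelySolvable.fderiv_rhsCLM_comm {G : Set (TD m n)}
    (hcs : CompletelySolvable X1 X2 G) {x : TD m n} (hx : x ∈ G)
    (h1 : ∀ ξ j, DifferentiableAt ℝ (X1 ξ j) x) (h2 : ∀ ξ j, DifferentiableAt ℝ (X2 ξ j) x)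
    (h k : Fin m → ℂ) :
    fderiv ℝ (rhsCLM X1 X2) x (h, rhsCLM X1 X2 x h) k =
      fderiv ℝ (rhsCLM X1 X2) x (k, rhsCLM X1 X2 x k) h := by
  ext τ
  rw [fderiv_rhsCLM_apply h1 h2, fderiv_rhsCLM_apply h1 h2]
  simp only [fderiv_apply_rhsCLM, Finset.sum_mul, ← Finset.sum_add_distrib]
  rw [Finset.sum_comm]
  refine Finset.sum_congr rfl fun j _ => Finset.sum_congr rfl fun ζ _ => ?_
  obtain ⟨a1, a2, a3⟩ := hcs τ j ζ x hx
  obtain ⟨b1, b2, b3⟩ := hcs τ ζ j x hx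
  rw [b1, b2, b3, ← a3]
  ring

theorem isSolution_iff_hasFDerivAt {w : (Fin m → ℂ) → Fin n → ℂ} {z : Fin m → ℂ} :
    ((∀ ξ, DifferentiableAt ℝ (fun y => w y ξ) z) ∧ ∀ ξ j,
      DzM j (fun y => w y ξ) z = X1 ξ j (z, w z) ∧
      DzbarM j (fun y => w y ξ) z = X2 ξ j (z, w z)) ↔
    HasFDerivAt w (rhsCLM X1 X2 (z, w z)) z := by
  rw [hasFDerivAt_pi']
  constructor
  · rintro ⟨hd, hs⟩ ξ
    refine (hd ξ).hasFDerivAt.congr_fderiv (ContinuousLinearMap.ext fun h => ?_)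
    rw [ContinuousLinearMap.apply_pi_eq_wirtinger (fderiv ℝ (fun y => w y ξ) z) h]
    refine Eq.trans (Finset.sum_congr rfl fun j _ => ?_) (rhsCLM_apply _ h ξ).symm
    rw [← (hs ξ j).1, ← (hs ξ j).2, DzM, DzbarM, wirtD, wirtD]
    ring
  · intro hd
    refine ⟨fun ξ => (hd ξ).differentiableAt, fun ξ j => ?_⟩
    have key : ∀ c : ℂ, fderiv ℝ (fun y => w y ξ) z (Pi.single j c) =
        X1 ξ j (z, w z) * c + X2 ξ j (z, w z) * (starRingEnd ℂ) c := fun c => by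
      rw [(hd ξ).fderiv]
      refine (rhsCLM_apply _ _ ξ).trans ?_
      rw [Finset.sum_eq_single j]
      · simp
      · intro i _ hi
        simp [hi]
      · simp
    constructor
    · simp only [DzM, wirtD, key, map_one, conj_I]
      linear_combination (-(X1 ξ j (z, w z)) + X2 ξ j (z, w z)) / 2 * I_sq
    · simp only [DzbarM, wirtD, map_neg, key, map_one, conj_I]
      linear_combination (X1 ξ j (z, w z) - X2 ξ j (z, w z)) / 2 * I_sq

theorem IsSolutionOn.eventually_hasFDerivAt {G : Set (TD m n)} {U : Set (Fin m → ℂ)}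
    {w : (Fin m → ℂ) → Fin n → ℂ} (hw : IsSolutionOn X1 X2 G U w) (hU : IsOpen U)
    {z0 : Fin m → ℂ} (hz0 : z0 ∈ U) :
    ∀ᶠ z in nhds z0, HasFDerivAt w (rhsCLM X1 X2 (z, w z)) z := by
  filter_upwards [hU.mem_nhds hz0] with z hz
  exact isSolution_iff_hasFDerivAt.1 ⟨hw.2.1 z hz, hw.2.2 z hz⟩

end TotalDifferential

/-- **Theorem 1.1 (Cauchy existence and uniqueness theorem for an
ℝ-holomorphic solution).**  If the entries of a completely solvable total
differential system (1.1) are ℝ-holomorphic at `(z⁰, w⁰) ∈ G`, then (1.1) has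
a solution on a neighborhood of `z⁰`, ℝ-holomorphic at `z⁰`, with
`w(z⁰) = w⁰`; and any two such solutions coincide on a neighborhood of
`z⁰`. -/
theorem statement_0 {m n : ℕ}
    (G : Set (TD m n)) (hGo : IsOpen G) (hGc : IsConnected G)
    (X1 X2 : Fin n → Fin m → TD m n → ℂ)
    (hX1 : ∀ ξ j, ∀ x ∈ G, DifferentiableAt ℝ (X1 ξ j) x)
    (hX2 : ∀ ξ j, ∀ x ∈ G, DifferentiableAt ℝ (X2 ξ j) x)
    (hcs : CompletelySolvable X1 X2 G)
    (z0 : Fin m → ℂ) (w0 : Fin n → ℂ) (hzw : (z0, w0) ∈ G)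
    (hanal1 : ∀ ξ j, RHolomorphicAt (X1 ξ j) (z0, w0))
    (hanal2 : ∀ ξ j, RHolomorphicAt (X2 ξ j) (z0, w0)) :
    (∃ U : Set (Fin m → ℂ), ∃ w : (Fin m → ℂ) → Fin n → ℂ,
      IsOpen U ∧ z0 ∈ U ∧ IsSolutionOn X1 X2 G U w ∧
      (∀ ξ, RHolomorphicAt (fun z => w z ξ) z0) ∧ w z0 = w0) ∧
    (∀ U V : Set (Fin m → ℂ), ∀ w w' : (Fin m → ℂ) → Fin n → ℂ,
      IsOpen U → IsOpen V → z0 ∈ U → z0 ∈ V →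
      IsSolutionOn X1 X2 G U w → IsSolutionOn X1 X2 G V w' →
      (∀ ξ, RHolomorphicAt (fun z => w z ξ) z0) →
      (∀ ξ, RHolomorphicAt (fun z => w' z ξ) z0) →
      w z0 = w0 → w' z0 = w0 →
      ∃ N : Set (Fin m → ℂ), N ∈ nhds z0 ∧ ∀ z ∈ N, w z = w' z) := by
  have hA : AnalyticAt ℝ (rhsCLM X1 X2) (z0, w0) := analyticAt_rhsCLM hanal1 hanal2
  refine ⟨?_, ?_⟩
  · obtain ⟨w, hw, hw0, hsol⟩ := exists_analyticAt_of_frobenius hA (by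
      filter_upwards [hGo.mem_nhds hzw] with x hx h k
      exact hcs.fderiv_rhsCLM_comm hx (fun ξ j => hX1 ξ j x hx) (fun ξ j => hX2 ξ j x hx) h k)
    have hG : ∀ᶠ z in nhds z0, (z, w z) ∈ G := by
      have hc : ContinuousAt (fun z => (z, w z)) z0 := continuousAt_id.prodMk hw.continuousAt
      refine hc.eventually_mem ?_
      rw [hw0]
      exact hGo.mem_nhds hzw
    obtain ⟨U, hU, hUo, hz0⟩ := eventually_nhds_iff.1 (hG.and hsol)
    refine ⟨U, w, hUo, hz0, ⟨fun z hz => (hU z hz).1, fun z hz => ?_, fun z hz => ?_⟩,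
      analyticAt_pi_iff.1 hw, hw0⟩
    · exact (isSolution_iff_hasFDerivAt.2 (hU z hz).2).1
    · exact (isSolution_iff_hasFDerivAt.2 (hU z hz).2).2
  · intro U V w w' hU hV hzU hzV hw hw' _ _ h0 h0'
    exact ⟨_, eventuallyEq_of_hasFDerivAt_of_analyticAt hA (hw.eventually_hasFDerivAt hU hzU)
      (hw'.eventually_hasFDerivAt hV hzV) h0 h0', fun z hz => hz⟩
end
end

section
/- Let (ψ^ε_{θ s₁}, ψ^ε_{g s₂}, ^λφ^ε), ε = 1,…,q, be solutions of systems of the form (1.14) (with possibly different right-hand sides h_l for different ε) such that the q vectors (ψ^ε_{1 s₁},…,ψ^ε_{s₁ s₁}, ψ^ε_{1 s₂},…,ψ^ε_{s₂ s₂}, ^λφ^ε)(z,w) ∈ ℂ^{s₁+s₂+λ} are linearly independent at every point of a domain G′ ⊆ G, and suppose that for each ε the associated Pfaffian equation (1.18) has a nowhere-vanishing integrating factor μ_ε and a general integral f_ε of the form f_ε(ˢz,ᵏw) on G′. Then f₁,…,f_q are functionally independent on G′: the q×(s₁+s₂+λ) Jacobian matrix of (f₁,…,f_q) with respect to the variables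 z₁,…,z_{s₁}, z̄_{j₁},…,z̄_{j_{s₂}}, w₁,…,w_{k₁}, w̄_{ζ₁},…,w̄_{ζ_{k₂}} (formed with Wirtinger derivatives) has rank q at every point of G′. -/
open Complex

noncomputable section

/-- Wronskian of a finite family of functions with respect to the first-order
differential operator `D` (iterated derivatives down the rows). -/
def wronskO {E : Type*} (D : (E → ℂ) → E → ℂ) {p : ℕ} (u : Fin p → E → ℂ)
    (x : E) : ℂ :=
  Matrix.det (Matrix.of fun i q : Fin p => D^[(i : ℕ)] (u q) x)

variable {m n : ℕ}

/-- All `2m` operators `𝔛_l`, `l = 1,…,2m`, indexed by `Fin m ⊕ Fin m`. -/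
def Xtot (X1 X2 : Fin n → Fin m → TD m n → ℂ) :
    Fin m ⊕ Fin m → (TD m n → ℂ) → TD m n → ℂ :=
  Sum.elim (Xop X1 X2) (XopBar X1 X2)

/-- The divergences `div 𝔛_l`, `l = 1,…,2m`. -/
def divX (X1 X2 : Fin n → Fin m → TD m n → ℂ) : Fin m ⊕ Fin m → TD m n → ℂ :=
  Sum.elim
    (fun j x => ∑ ξ : Fin n,
      (Dw ξ (X1 ξ j) x + Dwbar ξ (fun y => (starRingEnd ℂ) (X2 ξ j y)) x))
    (fun j x => ∑ ξ : Fin n,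
      (Dw ξ (X2 ξ j) x + Dwbar ξ (fun y => (starRingEnd ℂ) (X1 ξ j y)) x))

/-- `f` is of the form `f(ˢz, ᵏw)`: it is `(s₁,s₂)`-nonautonomous and
`(n−k₁,n−k₂)`-cylindrical, i.e. the Wirtinger derivatives with respect to all
omitted variables vanish on `S`. -/
def IsForm (s₁ s₂ k₁ k₂ : ℕ) (jp : Equiv.Perm (Fin m)) (ζp : Equiv.Perm (Fin n))
    (S : Set (TD m n)) (f : TD m n → ℂ) : Prop :=
  (∀ α : Fin m, s₁ ≤ (α : ℕ) → ∀ x ∈ S, Dz α f x = 0) ∧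
  (∀ β : Fin m, s₂ ≤ (β : ℕ) → ∀ x ∈ S, Dzbar (jp β) f x = 0) ∧
  (∀ γ : Fin n, k₁ ≤ (γ : ℕ) → ∀ x ∈ S, Dw γ f x = 0) ∧
  (∀ δ : Fin n, k₂ ≤ (δ : ℕ) → ∀ x ∈ S, Dwbar (ζp δ) f x = 0)

/-- The `w`-coordinate corresponding to the `i`-th component of `^λX^j`:
`w_i` for `i < k₁`, and `w_{ζ_{i−k₁}}` for the remaining `k₂` components. -/
def wIdx (k₁ k₂ : ℕ) (hk₁ : k₁ ≤ n) (hk₂ : k₂ ≤ n) (ζp : Equiv.Perm (Fin n))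
    (i : Fin (k₁ + k₂)) : Fin n :=
  if h : (i : ℕ) < k₁ then ⟨(i : ℕ), h.trans_le hk₁⟩
  else ζp ⟨(i : ℕ) - k₁, by have := i.isLt; omega⟩

/-- The vector function `^λX^j = (X_{1j},…,X_{k₁j}, conj X_{ζ₁,m+j},…,conj X_{ζ_{k₂},m+j})`. -/
def lamX (k₁ k₂ : ℕ) (hk₁ : k₁ ≤ n) (hk₂ : k₂ ≤ n) (ζp : Equiv.Perm (Fin n))
    (X1 X2 : Fin n → Fin m → TD m n → ℂ) (j : Fin m) (i : Fin (k₁ + k₂)) :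
    TD m n → ℂ :=
  fun x => if (i : ℕ) < k₁ then X1 (wIdx k₁ k₂ hk₁ hk₂ ζp i) j x
    else (starRingEnd ℂ) (X2 (wIdx k₁ k₂ hk₁ hk₂ ζp i) j x)

/-- The vector function `^λX^{m+j} = (X_{1,m+j},…,X_{k₁,m+j}, conj X_{ζ₁ j},…,conj X_{ζ_{k₂} j})`. -/
def lamX2 (k₁ k₂ : ℕ) (hk₁ : k₁ ≤ n) (hk₂ : k₂ ≤ n) (ζp : Equiv.Perm (Fin n))
    (X1 X2 : Fin n → Fin m → TD m n → ℂ) (j : Fin m) (i : Fin (k₁ + k₂)) :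
    TD m n → ℂ :=
  fun x => if (i : ℕ) < k₁ then X2 (wIdx k₁ k₂ hk₁ hk₂ ζp i) j x
    else (starRingEnd ℂ) (X1 (wIdx k₁ k₂ hk₁ hk₂ ζp i) j x)

/-- The Wirtinger derivative corresponding to the `i`-th retained `w`-variable:
`∂_{w_i}` for `i < k₁`, `∂_{w̄_{ζ_{i−k₁}}}` otherwise. -/
def wVarOp (k₁ k₂ : ℕ) (hk₁ : k₁ ≤ n) (hk₂ : k₂ ≤ n) (ζp : Equiv.Perm (Fin n))
    (i : Fin (k₁ + k₂)) : (TD m n → ℂ) → TD m n → ℂ :=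
  if (i : ℕ) < k₁ then Dw (wIdx k₁ k₂ hk₁ hk₂ ζp i)
  else Dwbar (wIdx k₁ k₂ hk₁ hk₂ ζp i)

/-- `D` is the Wirtinger derivative with respect to one of the omitted
variables `χ`. -/
def IsOmittedOp (s₁ s₂ k₁ k₂ : ℕ) (jp : Equiv.Perm (Fin m))
    (ζp : Equiv.Perm (Fin n)) (D : (TD m n → ℂ) → TD m n → ℂ) : Prop :=
  (∃ α : Fin m, s₁ ≤ (α : ℕ) ∧ D = Dz α) ∨
  (∃ β : Fin m, s₂ ≤ (β : ℕ) ∧ D = Dzbar (jp β)) ∨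
  (∃ γ : Fin n, k₁ ≤ (γ : ℕ) ∧ D = Dw γ) ∨
  (∃ δ : Fin n, k₂ ≤ (δ : ℕ) ∧ D = Dwbar (ζp δ))

/-- `f` is a partial integral of system (1.1) on `S`. -/
def PartialIntegral (X1 X2 : Fin n → Fin m → TD m n → ℂ) (S : Set (TD m n))
    (f : TD m n → ℂ) : Prop :=
  ∃ Φ : (Fin m ⊕ Fin m) → ℂ → TD m n → ℂ,
    (∀ l x, Φ l 0 x = 0) ∧ ∀ l, ∀ x ∈ S, Xtot X1 X2 l f x = Φ l (f x) x

/-- `F` is a first integral of system (1.1) on `S`. -/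
def FirstIntegral (X1 X2 : Fin n → Fin m → TD m n → ℂ) (S : Set (TD m n))
    (F : TD m n → ℂ) : Prop :=
  ∀ l, ∀ x ∈ S, Xtot X1 X2 l F x = 0

/-- `μ` is a last multiplier of system (1.1) on `S`. -/
def LastMultiplier (X1 X2 : Fin n → Fin m → TD m n → ℂ) (S : Set (TD m n))
    (μ : TD m n → ℂ) : Prop :=
  ∀ l, ∀ x ∈ S, Xtot X1 X2 l μ x = -(μ x * divX X1 X2 l x)

/-- System (1.14) with data `(ψ1, ψ2, φ)` and right-hand sides `h`. -/
def System114 (s₁ s₂ k₁ k₂ : ℕ) (hk₁ : k₁ ≤ n) (hk₂ : k₂ ≤ n)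
    (jp : Equiv.Perm (Fin m)) (ζp : Equiv.Perm (Fin n))
    (X1 X2 : Fin n → Fin m → TD m n → ℂ) (G : Set (TD m n))
    (ψ1 ψ2 : Fin m → TD m n → ℂ) (φ : Fin (k₁ + k₂) → TD m n → ℂ)
    (h : Fin m ⊕ Fin m → TD m n → ℂ) : Prop :=
  (∀ x ∈ G,
    (∀ θ : Fin m, (θ : ℕ) < s₁ →
      ψ1 θ x + ∑ i, φ i x * lamX k₁ k₂ hk₁ hk₂ ζp X1 X2 θ i x
        = h (Sum.inl θ) x) ∧
    (∀ η : Fin m, s₁ ≤ (η : ℕ) →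
      ∑ i, φ i x * lamX k₁ k₂ hk₁ hk₂ ζp X1 X2 η i x = h (Sum.inl η) x) ∧
    (∀ g : Fin m, (g : ℕ) < s₂ →
      ψ2 g x + ∑ i, φ i x * lamX2 k₁ k₂ hk₁ hk₂ ζp X1 X2 (jp g) i x
        = h (Sum.inr (jp g)) x) ∧
    (∀ ν : Fin m, s₂ ≤ (ν : ℕ) →
      ∑ i, φ i x * lamX2 k₁ k₂ hk₁ hk₂ ζp X1 X2 (jp ν) i x
        = h (Sum.inr (jp ν)) x)) ∧
  (∀ D, IsOmittedOp s₁ s₂ k₁ k₂ jp ζp D → ∀ x ∈ G,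
    (∀ θ : Fin m, (θ : ℕ) < s₁ → ∀ p, 1 ≤ p → p ≤ k₁ + k₂ →
      ∑ i, φ i x * D^[p] (lamX k₁ k₂ hk₁ hk₂ ζp X1 X2 θ i) x
        = D^[p] (h (Sum.inl θ)) x) ∧
    (∀ η : Fin m, s₁ ≤ (η : ℕ) → ∀ p, 1 ≤ p → p ≤ k₁ + k₂ - 1 →
      ∑ i, φ i x * D^[p] (lamX k₁ k₂ hk₁ hk₂ ζp X1 X2 η i) x
        = D^[p] (h (Sum.inl η)) x) ∧
    (∀ g : Fin m, (g : ℕ) < s₂ → ∀ p, 1 ≤ p → p ≤ k₁ + k₂ →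
      ∑ i, φ i x * D^[p] (lamX2 k₁ k₂ hk₁ hk₂ ζp X1 X2 (jp g) i) x
        = D^[p] (h (Sum.inr (jp g))) x) ∧
    (∀ ν : Fin m, s₂ ≤ (ν : ℕ) → ∀ p, 1 ≤ p → p ≤ k₁ + k₂ - 1 →
      ∑ i, φ i x * D^[p] (lamX2 k₁ k₂ hk₁ hk₂ ζp X1 X2 (jp ν) i) x
        = D^[p] (h (Sum.inr (jp ν))) x))

/-- `f` is a general integral of the Pfaffian equation (1.15)/(1.18) built from
`(ψ1, ψ2, φ)`, with integrating factor `μ` (the relations (1.16)). -/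
def PfaffGeneral (s₁ s₂ k₁ k₂ : ℕ) (hk₁ : k₁ ≤ n) (hk₂ : k₂ ≤ n)
    (jp : Equiv.Perm (Fin m)) (ζp : Equiv.Perm (Fin n)) (S : Set (TD m n))
    (ψ1 ψ2 : Fin m → TD m n → ℂ) (φ : Fin (k₁ + k₂) → TD m n → ℂ)
    (μ f : TD m n → ℂ) : Prop :=
  (∀ θ : Fin m, (θ : ℕ) < s₁ → ∀ x ∈ S, Dz θ f x = μ x * ψ1 θ x) ∧
  (∀ g : Fin m, (g : ℕ) < s₂ → ∀ x ∈ S, Dzbar (jp g) f x = μ x * ψ2 g x) ∧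
  (∀ i : Fin (k₁ + k₂), ∀ x ∈ S, wVarOp k₁ k₂ hk₁ hk₂ ζp i f x = μ x * φ i x)

/-- The Wirtinger derivative with respect to the `c`-th of the
`s₁ + s₂ + (k₁+k₂)` retained variables
`z₁,…,z_{s₁}, z̄_{j₁},…,z̄_{j_{s₂}}, w₁,…,w_{k₁}, w̄_{ζ₁},…,w̄_{ζ_{k₂}}`. -/
def allVarOp (s₁ s₂ k₁ k₂ : ℕ) (hs₁ : s₁ ≤ m) (hs₂ : s₂ ≤ m)
    (hk₁ : k₁ ≤ n) (hk₂ : k₂ ≤ n)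
    (jp : Equiv.Perm (Fin m)) (ζp : Equiv.Perm (Fin n))
    (c : Fin (s₁ + s₂ + (k₁ + k₂))) : (TD m n → ℂ) → TD m n → ℂ :=
  if h : (c : ℕ) < s₁ then Dz ⟨(c : ℕ), h.trans_le hs₁⟩
  else if h2 : (c : ℕ) < s₁ + s₂ then Dzbar (jp ⟨(c : ℕ) - s₁, by omega⟩)
  else wVarOp k₁ k₂ hk₁ hk₂ ζp ⟨(c : ℕ) - (s₁ + s₂), by have := c.isLt; omega⟩

/-- The vector `(ψ_{1 s₁},…,ψ_{s₁ s₁}, ψ_{1 s₂},…,ψ_{s₂ s₂}, ^λφ)(x) ∈ ℂ^{s₁+s₂+λ}`. -/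
def solVec (s₁ s₂ k₁ k₂ : ℕ) (hs₁ : s₁ ≤ m) (hs₂ : s₂ ≤ m)
    (ψ1 ψ2 : Fin m → TD m n → ℂ) (φ : Fin (k₁ + k₂) → TD m n → ℂ)
    (x : TD m n) (c : Fin (s₁ + s₂ + (k₁ + k₂))) : ℂ :=
  if h : (c : ℕ) < s₁ then ψ1 ⟨(c : ℕ), h.trans_le hs₁⟩ x
  else if h2 : (c : ℕ) < s₁ + s₂ then ψ2 ⟨(c : ℕ) - s₁, by omega⟩ x
  else φ ⟨(c : ℕ) - (s₁ + s₂), by have := c.isLt; omega⟩ x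

/-- Up to the integrating factor, the derivatives of a general integral with respect to the
retained variables form the solution vector. -/
theorem PfaffGeneral.allVarOp_eq {m n : ℕ} {s₁ s₂ k₁ k₂ : ℕ} (hs₁ : s₁ ≤ m) (hs₂ : s₂ ≤ m)
    {hk₁ : k₁ ≤ n} {hk₂ : k₂ ≤ n} {jp : Equiv.Perm (Fin m)} {ζp : Equiv.Perm (Fin n)}
    {S : Set (TD m n)} {ψ1 ψ2 : Fin m → TD m n → ℂ} {φ : Fin (k₁ + k₂) → TD m n → ℂ}
    {μ f : TD m n → ℂ} (hf : PfaffGeneral s₁ s₂ k₁ k₂ hk₁ hk₂ jp ζp S ψ1 ψ2 φ μ f)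
    {x : TD m n} (hx : x ∈ S) (c : Fin (s₁ + s₂ + (k₁ + k₂))) :
    allVarOp s₁ s₂ k₁ k₂ hs₁ hs₂ hk₁ hk₂ jp ζp c f x =
      μ x * solVec s₁ s₂ k₁ k₂ hs₁ hs₂ ψ1 ψ2 φ x c := by
  obtain ⟨hz, hzbar, hw⟩ := hf
  unfold allVarOp solVec
  split_ifs with h h2
  · exact hz _ h x hx
  · exact hzbar _ (by simp only; omega) x hx
  · exact hw _ x hx

/-- **Theorem 1.5.** If `(ψ^ε_{θs₁}, ψ^ε_{gs₂}, ^λφ^ε)`, `ε = 1,…,q`, are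
solutions of systems of the form (1.14) (with possibly different right-hand
sides) whose value vectors in `ℂ^{s₁+s₂+λ}` are linearly independent at every
point of `G′`, and for each `ε` the associated Pfaffian equation (1.18) has a
nowhere-vanishing integrating factor `μ_ε` and a general integral `f_ε` of the
form `f_ε(ˢz,ᵏw)` on `G′`, then `f₁,…,f_q` are functionally independent on
`G′`: their Jacobian matrix with respect to the retained variables has rank
`q` everywhere on `G′`. -/
theorem statement_4 {m n : ℕ} (s₁ s₂ k₁ k₂ : ℕ) (hs₁ : s₁ ≤ m) (hs₂ : s₂ ≤ m)
    (hk₁ : k₁ ≤ n) (hk₂ : k₂ ≤ n)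
    (jp : Equiv.Perm (Fin m)) (ζp : Equiv.Perm (Fin n))
    (G G' : Set (TD m n)) (hGo : IsOpen G) (hGc : IsConnected G)
    (hG'o : IsOpen G') (hG'c : IsConnected G') (hsub : G' ⊆ G)
    (X1 X2 : Fin n → Fin m → TD m n → ℂ)
    (hX1 : ∀ ξ j, ∀ x ∈ G, DifferentiableAt ℝ (X1 ξ j) x)
    (hX2 : ∀ ξ j, ∀ x ∈ G, DifferentiableAt ℝ (X2 ξ j) x)
    (q : ℕ) (ψ1 ψ2 : Fin q → Fin m → TD m n → ℂ)
    (φ : Fin q → Fin (k₁ + k₂) → TD m n → ℂ)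
    (h : Fin q → Fin m ⊕ Fin m → TD m n → ℂ)
    (hforms : ∀ ε : Fin q,
      (∀ θ : Fin m, (θ : ℕ) < s₁ → IsForm s₁ s₂ k₁ k₂ jp ζp G (ψ1 ε θ)) ∧
      (∀ g : Fin m, (g : ℕ) < s₂ → IsForm s₁ s₂ k₁ k₂ jp ζp G (ψ2 ε g)) ∧
      (∀ i : Fin (k₁ + k₂), IsForm s₁ s₂ k₁ k₂ jp ζp G (φ ε i)))
    (hsys : ∀ ε : Fin q,
      System114 s₁ s₂ k₁ k₂ hk₁ hk₂ jp ζp X1 X2 G (ψ1 ε) (ψ2 ε) (φ ε) (h ε))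
    (hli : ∀ x ∈ G', LinearIndependent ℂ
      (fun ε : Fin q => solVec s₁ s₂ k₁ k₂ hs₁ hs₂ (ψ1 ε) (ψ2 ε) (φ ε) x))
    (μ : Fin q → TD m n → ℂ) (hμ0 : ∀ ε, ∀ x ∈ G', μ ε x ≠ 0)
    (f : Fin q → TD m n → ℂ)
    (hfd : ∀ ε, ∀ x ∈ G', DifferentiableAt ℝ (f ε) x)
    (hfform : ∀ ε, IsForm s₁ s₂ k₁ k₂ jp ζp G' (f ε))
    (hgen : ∀ ε, PfaffGeneral s₁ s₂ k₁ k₂ hk₁ hk₂ jp ζp G'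
      (ψ1 ε) (ψ2 ε) (φ ε) (μ ε) (f ε)) :
    ∀ x ∈ G', (Matrix.of fun (ε : Fin q) (c : Fin (s₁ + s₂ + (k₁ + k₂))) =>
      allVarOp s₁ s₂ k₁ k₂ hs₁ hs₂ hk₁ hk₂ jp ζp c (f ε) x).rank = q := by
  intro x hx
  have hrow : LinearIndependent ℂ fun (ε : Fin q) (c : Fin (s₁ + s₂ + (k₁ + k₂))) =>
      μ ε x * solVec s₁ s₂ k₁ k₂ hs₁ hs₂ (ψ1 ε) (ψ2 ε) (φ ε) x c :=
    (hli x hx).units_smul fun ε => Units.mk0 (μ ε x) (hμ0 ε x hx)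
  simp_rw [fun ε => (hgen ε).allVarOp_eq hs₁ hs₂ hx]
  exact (LinearIndependent.rank_matrix hrow).trans (Fintype.card_fin q)
end
end

section
/- Let (ψ^ε_{θ s₁}, ψ^ε_{g s₂}, ^λφ^ε), ε = 1,…,q, be solutions of system (1.14) with right-hand sides h_l = −div 𝔛_l (l = 1,…,2m) such that the q vectors (ψ^ε_{1 s₁},…,ψ^ε_{s₁ s₁}, ψ^ε_{1 s₂},…,ψ^ε_{s₂ s₂}, ^λφ^ε)(z,w) ∈ ℂ^{s₁+s₂+λ} are linearly independent at every point of a domain G′ ⊆ G, and suppose each associated Pfaffian equation (1.18) admits the integrating factor 1, i.e., there are ℝ-differentiable functions g_ε of the form (ˢz,ᵏw) with ∂_{z_θ} g_ε = ψ^ε_{θ s₁}, ∂_{z̄_{j_g}} g_ε = ψ^ε_{g s₂}, ∂_{w_ξ} g_ε = φ^ε_{ξ k₁}, ∂_{w̄_{ζ_τ}} g_ε = φ^ε_{τ k₂}. Then the functions μ_ε = exp(g_ε), ε = 1,…,q, are last multipliers of (1.1) and are functionally independent on G′: the q×(s₁+s₂+λ) Jacobian matrix of (μ₁,…,μ_q)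 with respect to the variables z₁,…,z_{s₁}, z̄_{j₁},…,z̄_{j_{s₂}}, w₁,…,w_{k₁}, w̄_{ζ₁},…,w̄_{ζ_{k₂}} (formed with Wirtinger derivatives) has rank q at every point of G′. -/
open Complex

noncomputable section

variable {m n : ℕ}

theorem wirtD_cexp {E : Type*} [NormedAddCommGroup E] [NormedSpace ℝ E] (v iv : E)
    {f : E → ℂ} {x : E} (hf : DifferentiableAt ℝ f x) :
    wirtD v iv (fun y => Complex.exp (f y)) x = Complex.exp (f x) * wirtD v iv f x := by
  simp only [wirtD, hf.hasFDerivAt.cexp.fderiv, smul_apply, smul_eq_mul]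
  ring

theorem wVarOp_cexp (k₁ k₂ : ℕ) (hk₁ : k₁ ≤ n) (hk₂ : k₂ ≤ n) (ζp : Equiv.Perm (Fin n))
    (i : Fin (k₁ + k₂)) {f : TD m n → ℂ} {x : TD m n} (hf : DifferentiableAt ℝ f x) :
    wVarOp k₁ k₂ hk₁ hk₂ ζp i (fun y => Complex.exp (f y)) x =
      Complex.exp (f x) * wVarOp k₁ k₂ hk₁ hk₂ ζp i f x := by
  unfold wVarOp
  split_ifs
  exacts [wirtD_cexp _ _ hf, wirtD_cexp _ _ hf]

theorem allVarOp_cexp (s₁ s₂ k₁ k₂ : ℕ) (hs₁ : s₁ ≤ m) (hs₂ : s₂ ≤ m)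
    (hk₁ : k₁ ≤ n) (hk₂ : k₂ ≤ n) (jp : Equiv.Perm (Fin m)) (ζp : Equiv.Perm (Fin n))
    (c : Fin (s₁ + s₂ + (k₁ + k₂))) {f : TD m n → ℂ} {x : TD m n}
    (hf : DifferentiableAt ℝ f x) :
    allVarOp s₁ s₂ k₁ k₂ hs₁ hs₂ hk₁ hk₂ jp ζp c (fun y => Complex.exp (f y)) x =
      Complex.exp (f x) * allVarOp s₁ s₂ k₁ k₂ hs₁ hs₂ hk₁ hk₂ jp ζp c f x := by
  unfold allVarOp
  split_ifs
  exacts [wirtD_cexp _ _ hf, wirtD_cexp _ _ hf, wVarOp_cexp _ _ _ _ _ _ hf]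

theorem Fin.sum_univ_eq_sum_castLE {M : Type*} [AddCommMonoid M] {k n : ℕ} (h : k ≤ n)
    (f : Fin n → M) (hf : ∀ i : Fin n, k ≤ (i : ℕ) → f i = 0) :
    ∑ i, f i = ∑ i : Fin k, f (Fin.castLE h i) := by
  obtain ⟨l, rfl⟩ := Nat.exists_eq_add_of_le h
  rw [Fin.sum_univ_add, Fintype.sum_eq_zero (fun i : Fin l => f (Fin.natAdd k i))
    (fun i => hf _ (by simp)), add_zero]
  rfl

/-- For `f` of the form `(ˢz,ᵏw)`, only the retained `w`-variables contribute to a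
first-order operator in the `w`-variables. -/
theorem IsForm.sum_Dw_add_Dwbar {s₁ s₂ k₁ k₂ : ℕ} (hk₁ : k₁ ≤ n) (hk₂ : k₂ ≤ n)
    {jp : Equiv.Perm (Fin m)} {ζp : Equiv.Perm (Fin n)} {S : Set (TD m n)}
    {f : TD m n → ℂ} (hf : IsForm s₁ s₂ k₁ k₂ jp ζp S f) {x : TD m n} (hx : x ∈ S)
    (a b : Fin n → ℂ) :
    ∑ ξ, (a ξ * Dw ξ f x + b ξ * Dwbar ξ f x) =
      ∑ i : Fin (k₁ + k₂), wVarOp k₁ k₂ hk₁ hk₂ ζp i f x *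
        (if (i : ℕ) < k₁ then a (wIdx k₁ k₂ hk₁ hk₂ ζp i)
          else b (wIdx k₁ k₂ hk₁ hk₂ ζp i)) := by
  obtain ⟨-, -, hw, hwbar⟩ := hf
  rw [Finset.sum_add_distrib, Fin.sum_univ_add,
    Fin.sum_univ_eq_sum_castLE hk₁ (fun ξ => a ξ * Dw ξ f x)
      (fun ξ hξ => by rw [hw ξ hξ x hx, mul_zero]),
    ← Equiv.sum_comp ζp (fun ξ => b ξ * Dwbar ξ f x),
    Fin.sum_univ_eq_sum_castLE hk₂ (fun δ => b (ζp δ) * Dwbar (ζp δ) f x)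
      (fun δ hδ => by rw [hwbar δ hδ x hx, mul_zero])]
  congr 1
  · refine Finset.sum_congr rfl fun i _ => ?_
    simp [wVarOp, wIdx, mul_comm, Fin.castLE]
  · refine Finset.sum_congr rfl fun i _ => ?_
    simp [wVarOp, wIdx, mul_comm, Fin.castLE]

theorem Xtot_cexp (X1 X2 : Fin n → Fin m → TD m n → ℂ) (l : Fin m ⊕ Fin m)
    {f : TD m n → ℂ} {x : TD m n} (hf : DifferentiableAt ℝ f x) :
    Xtot X1 X2 l (fun y => Complex.exp (f y)) x = Complex.exp (f x) * Xtot X1 X2 l f x := by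
  have key (v iv : TD m n) := wirtD_cexp v iv hf
  rcases l with j | j <;>
    simp only [Xtot, Sum.elim_inl, Sum.elim_inr, Xop, XopBar, Dz, Dzbar, Dw, Dwbar, key,
      mul_add, Finset.mul_sum, mul_left_comm]

theorem allVarOp_eq_solVec {s₁ s₂ k₁ k₂ : ℕ} (hs₁ : s₁ ≤ m) (hs₂ : s₂ ≤ m)
    (hk₁ : k₁ ≤ n) (hk₂ : k₂ ≤ n) {jp : Equiv.Perm (Fin m)} {ζp : Equiv.Perm (Fin n)}
    {ψ1 ψ2 : Fin m → TD m n → ℂ} {φ : Fin (k₁ + k₂) → TD m n → ℂ}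
    {f : TD m n → ℂ} {x : TD m n}
    (hz : ∀ θ : Fin m, (θ : ℕ) < s₁ → Dz θ f x = ψ1 θ x)
    (hzbar : ∀ g : Fin m, (g : ℕ) < s₂ → Dzbar (jp g) f x = ψ2 g x)
    (hw : ∀ i, wVarOp k₁ k₂ hk₁ hk₂ ζp i f x = φ i x) (c : Fin (s₁ + s₂ + (k₁ + k₂))) :
    allVarOp s₁ s₂ k₁ k₂ hs₁ hs₂ hk₁ hk₂ jp ζp c f x =
      solVec s₁ s₂ k₁ k₂ hs₁ hs₂ ψ1 ψ2 φ x c := by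
  unfold allVarOp solVec
  split_ifs with h h2
  · exact hz _ h
  · exact hzbar _ (by simp only; omega)
  · exact hw _

/-- If `f` is of the form `(ˢz,ᵏw)` and its derivatives solve system (1.14) with right-hand
sides `h`, then `𝔛_l f = h_l`. -/
theorem System114.Xtot_eq {s₁ s₂ k₁ k₂ : ℕ} {hk₁ : k₁ ≤ n} {hk₂ : k₂ ≤ n}
    {jp : Equiv.Perm (Fin m)} {ζp : Equiv.Perm (Fin n)}
    {X1 X2 : Fin n → Fin m → TD m n → ℂ} {G : Set (TD m n)}
    {ψ1 ψ2 : Fin m → TD m n → ℂ} {φ : Fin (k₁ + k₂) → TD m n → ℂ}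
    {h : Fin m ⊕ Fin m → TD m n → ℂ}
    (hsys : System114 s₁ s₂ k₁ k₂ hk₁ hk₂ jp ζp X1 X2 G ψ1 ψ2 φ h)
    {f : TD m n → ℂ} (hf : IsForm s₁ s₂ k₁ k₂ jp ζp G f) {x : TD m n} (hx : x ∈ G)
    (hz : ∀ θ : Fin m, (θ : ℕ) < s₁ → Dz θ f x = ψ1 θ x)
    (hzbar : ∀ g : Fin m, (g : ℕ) < s₂ → Dzbar (jp g) f x = ψ2 g x)
    (hw : ∀ i, wVarOp k₁ k₂ hk₁ hk₂ ζp i f x = φ i x) (l : Fin m ⊕ Fin m) :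
    Xtot X1 X2 l f x = h l x := by
  obtain ⟨h₁, h₂, h₃, h₄⟩ := hsys.1 x hx
  rcases l with j | j
  · simp only [Xtot, Sum.elim_inl, Xop, hf.sum_Dw_add_Dwbar hk₁ hk₂ hx, hw]
    rcases lt_or_ge (j : ℕ) s₁ with hj | hj
    · rw [hz j hj]
      exact h₁ j hj
    · rw [hf.1 j hj x hx, zero_add]
      exact h₂ j hj
  · obtain ⟨j, rfl⟩ := jp.surjective j
    simp only [Xtot, Sum.elim_inr, XopBar, hf.sum_Dw_add_Dwbar hk₁ hk₂ hx, hw]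
    rcases lt_or_ge (j : ℕ) s₂ with hj | hj
    · rw [hzbar j hj]
      exact h₃ j hj
    · rw [hf.2.1 j hj x hx, zero_add]
      exact h₄ j hj

/-- **Theorem 1.11.** If `(ψ^ε_{θs₁}, ψ^ε_{gs₂}, ^λφ^ε)`, `ε = 1,…,q`, are
solutions of system (1.14) with right-hand sides `h_l = −div 𝔛_l` whose value
vectors in `ℂ^{s₁+s₂+λ}` are linearly independent at every point of `G′`, and
each associated Pfaffian equation (1.18) admits the integrating factor `1`
(with potential `g_ε` of the form `(ˢz,ᵏw)`), then the functions
`μ_ε = exp g_ε` are last multipliers of (1.1) and are functionally independent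
on `G′`. -/
theorem statement_10 {m n : ℕ} (s₁ s₂ k₁ k₂ : ℕ) (hs₁ : s₁ ≤ m) (hs₂ : s₂ ≤ m)
    (hk₁ : k₁ ≤ n) (hk₂ : k₂ ≤ n)
    (jp : Equiv.Perm (Fin m)) (ζp : Equiv.Perm (Fin n))
    (G G' : Set (TD m n)) (hGo : IsOpen G) (hGc : IsConnected G)
    (hG'o : IsOpen G') (hG'c : IsConnected G') (hsub : G' ⊆ G)
    (X1 X2 : Fin n → Fin m → TD m n → ℂ)
    (hX1 : ∀ ξ j, ∀ x ∈ G, DifferentiableAt ℝ (X1 ξ j) x)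
    (hX2 : ∀ ξ j, ∀ x ∈ G, DifferentiableAt ℝ (X2 ξ j) x)
    (q : ℕ) (ψ1 ψ2 : Fin q → Fin m → TD m n → ℂ)
    (φ : Fin q → Fin (k₁ + k₂) → TD m n → ℂ)
    (hforms : ∀ ε : Fin q,
      (∀ θ : Fin m, (θ : ℕ) < s₁ → IsForm s₁ s₂ k₁ k₂ jp ζp G (ψ1 ε θ)) ∧
      (∀ g : Fin m, (g : ℕ) < s₂ → IsForm s₁ s₂ k₁ k₂ jp ζp G (ψ2 ε g)) ∧
      (∀ i : Fin (k₁ + k₂), IsForm s₁ s₂ k₁ k₂ jp ζp G (φ ε i)))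
    (hsys : ∀ ε : Fin q, System114 s₁ s₂ k₁ k₂ hk₁ hk₂ jp ζp X1 X2 G
      (ψ1 ε) (ψ2 ε) (φ ε) (fun l x => -(divX X1 X2 l x)))
    (hli : ∀ x ∈ G', LinearIndependent ℂ
      (fun ε : Fin q => solVec s₁ s₂ k₁ k₂ hs₁ hs₂ (ψ1 ε) (ψ2 ε) (φ ε) x))
    (g : Fin q → TD m n → ℂ)
    (hgd : ∀ ε, ∀ x ∈ G, DifferentiableAt ℝ (g ε) x)
    (hgform : ∀ ε, IsForm s₁ s₂ k₁ k₂ jp ζp G (g ε))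
    (hgrad : ∀ ε : Fin q,
      (∀ θ : Fin m, (θ : ℕ) < s₁ → ∀ x ∈ G, Dz θ (g ε) x = ψ1 ε θ x) ∧
      (∀ gi : Fin m, (gi : ℕ) < s₂ → ∀ x ∈ G,
        Dzbar (jp gi) (g ε) x = ψ2 ε gi x) ∧
      (∀ i : Fin (k₁ + k₂), ∀ x ∈ G,
        wVarOp k₁ k₂ hk₁ hk₂ ζp i (g ε) x = φ ε i x)) :
    (∀ ε, LastMultiplier X1 X2 G' (fun x => Complex.exp (g ε x))) ∧
    ∀ x ∈ G', (Matrix.of fun (ε : Fin q) (c : Fin (s₁ + s₂ + (k₁ + k₂))) =>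
      allVarOp s₁ s₂ k₁ k₂ hs₁ hs₂ hk₁ hk₂ jp ζp c
        (fun y => Complex.exp (g ε y)) x).rank = q := by
  refine ⟨fun ε l x hx => ?_, fun x hx => ?_⟩
  · obtain ⟨hz, hzbar, hw⟩ := hgrad ε
    have hxG := hsub hx
    rw [Xtot_cexp X1 X2 l (hgd ε x hxG),
      (hsys ε).Xtot_eq (hgform ε) hxG (fun θ hθ => hz θ hθ x hxG)
        (fun gi hgi => hzbar gi hgi x hxG) (fun i => hw i x hxG) l, mul_neg]
  · have hxG := hsub hx
    have hind := (hli x hx).units_smul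
      (fun ε => Units.mk0 (Complex.exp (g ε x)) (Complex.exp_ne_zero _))
    refine (LinearIndependent.rank_matrix ?_).trans (Fintype.card_fin q)
    refine cast (congrArg (fun v => LinearIndependent ℂ v) ?_) hind
    ext ε c
    obtain ⟨hz, hzbar, hw⟩ := hgrad ε
    simp only [Matrix.row, Matrix.of_apply, Pi.smul_apply', Pi.smul_apply, Units.smul_mk0,
      smul_eq_mul]
    rw [allVarOp_cexp _ _ _ _ _ _ _ _ _ _ _ (hgd ε x hxG),
      allVarOp_eq_solVec hs₁ hs₂ hk₁ hk₂ (fun θ hθ => hz θ hθ x hxG)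
        (fun gi hgi => hzbar gi hgi x hxG) (fun i => hw i x hxG)]
end
end

section
/- Let the system (2.25) be Jacobian, and let ν¹,…,ν^{m+1} ∈ ℂ^{2n} be nonzero common eigenvectors of A₁,…,A_m, with A_j ν^θ = λ_θ^j ν^θ for j = 1,…,m and θ = 1,…,m+1. Let (h₁,…,h_{m+1}) be a nontrivial solution of the linear system Σ_{θ=1}^{m+1} λ_θ^j h_θ = 0, j = 1,…,m (such a solution exists, since there are m equations in m+1 unknowns). Let Ω ⊆ ℂ^n be a domain on which each ν^θ·γ is nonzero and admits an ℝ-differentiable branch L_θ of its logarithm (exp∘L_θ = ν^θ·γ on Ω). Then the function F = exp( Σ_{θ=1}^{m+1} h_θ L_θ ), i.e., F = Π_{θ=1}^{m+1} (ν^θ·γ)^{h_θ}, is an ℝ-differentiable first integral of (2.25) on Ω: 𝔏_j F = 0 on Ω for all j = 1,…,m. -/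
open Complex

noncomputable section

variable {n m : ℕ}

/-- Wirtinger derivative `∂_{z_ξ}` on `ℂ^n`. -/
def DzV (ξ : Fin n) : ((Fin n → ℂ) → ℂ) → (Fin n → ℂ) → ℂ :=
  wirtD (Pi.single ξ 1) (Pi.single ξ Complex.I)

/-- Wirtinger derivative `∂_{z̄_ξ}` on `ℂ^n`. -/
def DzbarV (ξ : Fin n) : ((Fin n → ℂ) → ℂ) → (Fin n → ℂ) → ℂ :=
  wirtD (Pi.single ξ 1) (-Pi.single ξ Complex.I)

/-- `γ(z) = (z₁,…,z_n, z̄₁,…,z̄_n)`, indexed by `Fin n ⊕ Fin n`. -/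
def gam (z : Fin n → ℂ) : Fin n ⊕ Fin n → ℂ :=
  Sum.elim z fun ξ => (starRingEnd ℂ) (z ξ)

/-- `b·γ(z) = ∑ l b_l γ(z)_l`. -/
def dotg (b : Fin n ⊕ Fin n → ℂ) (z : Fin n → ℂ) : ℂ :=
  ∑ l, b l * gam z l

/-- The linear map `A_j : ℂ^{2n} → ℂ^{2n}`, `(A_j b)_l = ∑_k a_{jkl} b_k`. -/
def Amap (a : Fin m → (Fin n ⊕ Fin n) → (Fin n ⊕ Fin n) → ℂ) (j : Fin m)
    (b : Fin n ⊕ Fin n → ℂ) : Fin n ⊕ Fin n → ℂ :=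
  fun l => ∑ k, a j k l * b k

/-- The operator `𝔏_j` of system (2.25), with ℝ-linear coefficients
`a_{jk}(z) = ∑_τ a_{jkτ} γ(z)_τ`. -/
def Lop (a : Fin m → (Fin n ⊕ Fin n) → (Fin n ⊕ Fin n) → ℂ) (j : Fin m)
    (F : (Fin n → ℂ) → ℂ) : (Fin n → ℂ) → ℂ :=
  fun z => ∑ ξ : Fin n,
    ((∑ τ, a j (Sum.inl ξ) τ * gam z τ) * DzV ξ F z +
     (∑ τ, a j (Sum.inr ξ) τ * gam z τ) * DzbarV ξ F z)

/-- The system (2.25) is Jacobian: all Poisson brackets `[𝔏_j, 𝔏_ζ]`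
vanish. -/
def Jacobian (a : Fin m → (Fin n ⊕ Fin n) → (Fin n ⊕ Fin n) → ℂ) : Prop :=
  ∀ j ζ : Fin m, ∀ F : (Fin n → ℂ) → ℂ, ContDiff ℝ (⊤ : ℕ∞) F →
    ∀ z, Lop a j (Lop a ζ F) z = Lop a ζ (Lop a j F) z

/-- The symbol of `Lop a j` at `z`, a `ℂ`-linear functional on real differentials. -/
def LopSymbol (a : Fin m → (Fin n ⊕ Fin n) → (Fin n ⊕ Fin n) → ℂ) (j : Fin m)
    (z : Fin n → ℂ) : ((Fin n → ℂ) →L[ℝ] ℂ) →ₗ[ℂ] ℂ where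
  toFun D := ∑ ξ : Fin n,
    ((∑ τ, a j (Sum.inl ξ) τ * gam z τ) *
        ((D (Pi.single ξ 1) - Complex.I * D (Pi.single ξ Complex.I)) / 2) +
     (∑ τ, a j (Sum.inr ξ) τ * gam z τ) *
        ((D (Pi.single ξ 1) - Complex.I * D (-Pi.single ξ Complex.I)) / 2))
  map_add' D D' := by
    rw [← Finset.sum_add_distrib]
    refine Finset.sum_congr rfl fun ξ _ => ?_
    simp only [add_apply]
    ring
  map_smul' c D := by
    rw [RingHom.id_apply, smul_eq_mul, Finset.mul_sum]
    refine Finset.sum_congr rfl fun ξ _ => ?_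
    simp only [smul_apply, smul_eq_mul]
    ring

lemma Lop_eq_LopSymbol (a : Fin m → (Fin n ⊕ Fin n) → (Fin n ⊕ Fin n) → ℂ) (j : Fin m)
    (F : (Fin n → ℂ) → ℂ) (z : Fin n → ℂ) :
    Lop a j F z = LopSymbol a j z (fderiv ℝ F z) := rfl

/-- `dotg b` as a continuous real-linear functional. -/
def dotgCLM (b : Fin n ⊕ Fin n → ℂ) : (Fin n → ℂ) →L[ℝ] ℂ :=
  LinearMap.toContinuousLinearMap
    { toFun := dotg b
      map_add' := fun x y => by
        simp only [dotg, gam, Fintype.sum_sum_type, Sum.elim_inl, Sum.elim_inr, Pi.add_apply,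
          map_add, mul_add, Finset.sum_add_distrib]
        ring
      map_smul' := fun c x => by
        simp only [dotg, gam, Fintype.sum_sum_type, Sum.elim_inl, Sum.elim_inr, Pi.smul_apply,
          real_smul, map_mul, conj_ofReal, RingHom.id_apply, mul_add, Finset.mul_sum,
          mul_left_comm] }

lemma dotgCLM_apply (b : Fin n ⊕ Fin n → ℂ) (z : Fin n → ℂ) : dotgCLM b z = dotg b z := rfl

lemma dotg_single (b : Fin n ⊕ Fin n → ℂ) (ξ : Fin n) (c : ℂ) :
    dotg b (Pi.single ξ c) = b (Sum.inl ξ) * c + b (Sum.inr ξ) * (starRingEnd ℂ) c := by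
  simp [dotg, gam, Fintype.sum_sum_type, Pi.single_apply, apply_ite (starRingEnd ℂ)]

lemma fderiv_dotg (b : Fin n ⊕ Fin n → ℂ) (z : Fin n → ℂ) :
    fderiv ℝ (dotg b) z = dotgCLM b :=
  (dotgCLM b).hasFDerivAt.fderiv

lemma Lop_dotg (a : Fin m → (Fin n ⊕ Fin n) → (Fin n ⊕ Fin n) → ℂ) (j : Fin m)
    (b : Fin n ⊕ Fin n → ℂ) (z : Fin n → ℂ) :
    Lop a j (dotg b) z = dotg (Amap a j b) z := by
  have hz : ∀ ξ, DzV ξ (dotg b) z = b (Sum.inl ξ) := fun ξ => by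
    simp only [DzV, wirtD, fderiv_dotg, dotgCLM_apply, dotg_single, map_one, conj_I]
    linear_combination (-(b (Sum.inl ξ) - b (Sum.inr ξ)) / 2) * I_mul_I
  have hzbar : ∀ ξ, DzbarV ξ (dotg b) z = b (Sum.inr ξ) := fun ξ => by
    simp only [DzbarV, wirtD, fderiv_dotg, map_neg, dotgCLM_apply, dotg_single, map_one, conj_I]
    linear_combination ((b (Sum.inl ξ) - b (Sum.inr ξ)) / 2) * I_mul_I
  have hk : Lop a j (dotg b) z = ∑ k, (∑ τ, a j k τ * gam z τ) * b k := by
    simp only [Lop, hz, hzbar, Fintype.sum_sum_type (f := fun k => (∑ τ, a j k τ * gam z τ) * b k),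
      Finset.sum_add_distrib]
  simp only [hk, dotg, Amap, Finset.sum_mul]
  rw [Finset.sum_comm]
  exact Finset.sum_congr rfl fun l _ => Finset.sum_congr rfl fun k _ => by ring

/-- A logarithm of `b·γ` is mapped by `𝔏_j` to the eigenvalue of `b`. -/
lemma Lop_log_dotg {a : Fin m → (Fin n ⊕ Fin n) → (Fin n ⊕ Fin n) → ℂ} {j : Fin m}
    {b : Fin n ⊕ Fin n → ℂ} {μ : ℂ} (hb : Amap a j b = μ • b) {l : (Fin n → ℂ) → ℂ}
    {z : Fin n → ℂ} (hl : DifferentiableAt ℝ l z)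
    (hexp : (fun y => Complex.exp (l y)) =ᶠ[nhds z] dotg b) :
    Lop a j l z = μ := by
  have hD : fderiv ℝ (dotg b) z = dotg b z • fderiv ℝ l z := by
    rw [← hexp.fderiv_eq, ← hexp.eq_of_nhds]
    exact hl.hasFDerivAt.cexp.fderiv
  have hne : dotg b z ≠ 0 := hexp.eq_of_nhds ▸ Complex.exp_ne_zero (l z)
  have hsmul : dotg (μ • b) z = μ * dotg b z := by
    simp only [dotg, Pi.smul_apply, smul_eq_mul, Finset.mul_sum, mul_assoc]
  have key := Lop_dotg a j b z
  rw [hb, hsmul, Lop_eq_LopSymbol, hD, map_smul, smul_eq_mul, mul_comm] at key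
  exact mul_right_cancel₀ hne key

/-- **Theorem 2.10.** Let the system (2.25) be Jacobian and let
`ν¹,…,ν^{m+1}` be nonzero common eigenvectors of `A₁,…,A_m` with
`A_j ν^θ = λ_θ^j ν^θ`.  If `(h₁,…,h_{m+1})` is a nontrivial solution of
`∑_θ λ_θ^j h_θ = 0` (`j = 1,…,m`) and on a domain `Ω` each `ν^θ·γ` is nonzero
with an ℝ-differentiable logarithm `L_θ`, then
`F = ∏_θ (ν^θ·γ)^{h_θ} = exp(∑_θ h_θ L_θ)` is an ℝ-differentiable first
integral of (2.25) on `Ω`. -/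
theorem statement_16 {n m : ℕ}
    (a : Fin m → (Fin n ⊕ Fin n) → (Fin n ⊕ Fin n) → ℂ)
    (hJac : Jacobian a)
    (ν : Fin (m + 1) → Fin n ⊕ Fin n → ℂ) (hν : ∀ θ, ν θ ≠ 0)
    (lam : Fin (m + 1) → Fin m → ℂ)
    (heig : ∀ θ j, Amap a j (ν θ) = lam θ j • ν θ)
    (h : Fin (m + 1) → ℂ) (hh : h ≠ 0)
    (hsol : ∀ j, ∑ θ, lam θ j * h θ = 0)
    (Ω : Set (Fin n → ℂ)) (hΩo : IsOpen Ω) (hΩc : IsConnected Ω)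
    (hnz : ∀ θ, ∀ z ∈ Ω, dotg (ν θ) z ≠ 0)
    (L : Fin (m + 1) → (Fin n → ℂ) → ℂ)
    (hL : ∀ θ, ∀ z ∈ Ω, DifferentiableAt ℝ (L θ) z)
    (hexp : ∀ θ, ∀ z ∈ Ω, Complex.exp (L θ z) = dotg (ν θ) z) :
    ∀ j, ∀ z ∈ Ω,
      Lop a j (fun y => Complex.exp (∑ θ, h θ * L θ y)) z = 0 := by
  intro j z hz
  have hlog : ∀ θ, LopSymbol a j z (fderiv ℝ (L θ) z) = lam θ j := fun θ =>
    Lop_log_dotg (heig θ j) (hL θ z hz)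
      (Filter.eventually_of_mem (hΩo.mem_nhds hz) (hexp θ))
  have hF : HasFDerivAt (fun y => Complex.exp (∑ θ, h θ * L θ y))
      (Complex.exp (∑ θ, h θ * L θ z) • ∑ θ, h θ • fderiv ℝ (L θ) z) z :=
    (HasFDerivAt.fun_sum fun θ _ => (hL θ z hz).hasFDerivAt.const_mul (h θ)).cexp
  rw [Lop_eq_LopSymbol, hF.fderiv, map_smul, map_sum]
  simp only [map_smul, hlog, smul_eq_mul]
  simp only [hsol j, mul_comm (h _), mul_zero]
end
end
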